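/- Let n ≥ 1 and let A ∈ ℝmax^{n×n} be such that 𝒟(A) contains at least one cycle (so λ(A) ≠ −∞). Let B^{ct} be obtained from A by the cycle threshold scheme. Then T_1(A,B^{ct}) ≤ Wi(n), where Wi is the Wielandt number. -/

import Mathlib

open Classical

noncomputable section

namespace MaxPlus

/-- A square matrix over the max-plus semiring `ℝmax = ℝ ∪ {-∞}`,
represented as `WithBot ℝ` (with `⊥ = -∞`, `+` the usual addition). -/
abbrev MPMat (n : ℕ) := Fin n → Fin n → WithBot ℝ

variable {n : ℕ}

/-- Max-plus matrix multiplication: `(A⊗B)_{ij} = max_k (a_{ik} + b_{kj})`. -/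
def mpMul (A B : MPMat n) : MPMat n := fun i j => Finset.univ.sup fun k => A i k + B k j

/-- Max-plus matrix power, with `A^0` the max-plus identity. -/
def mpPow (A : MPMat n) : ℕ → MPMat n
  | 0 => fun i j => if i = j then (0 : WithBot ℝ) else ⊥
  | t + 1 => mpMul A (mpPow A t)

/-- Max-plus matrix-vector product. -/
def mpMulVec (A : MPMat n) (x : Fin n → WithBot ℝ) : Fin n → WithBot ℝ :=
  fun i => Finset.univ.sup fun k => A i k + x k

/-- A digraph on the node set `{1,…,n}`: a set of vertices together with an
edge relation. -/
structure SubD (n : ℕ) where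
  verts : Set (Fin n)
  edge : Fin n → Fin n → Prop

/-- The weighted digraph `𝒟(A)` of a max-plus matrix: all `n` nodes, with an
edge `(i,j)` whenever `a_{ij} ≠ -∞`. -/
def digr (A : MPMat n) : SubD n := ⟨Set.univ, fun i j => A i j ≠ ⊥⟩

/-- `W` (a nonempty list of nodes) is a walk in the digraph `G`. -/
def IsWalkIn (G : SubD n) (W : List (Fin n)) : Prop :=
  W ≠ [] ∧ (∀ v ∈ W, v ∈ G.verts) ∧ W.Chain' G.edge

/-- The length of a walk: its number of edges (number of nodes minus one). -/
def elen (W : List (Fin n)) : ℕ := W.length - 1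

/-- The weight `p(W)` of a walk: sum of the weights of its edges. -/
def walkWeight (A : MPMat n) (W : List (Fin n)) : WithBot ℝ :=
  ((W.zip W.tail).map fun p => A p.1 p.2).sum

/-- `W` is a cycle in `G`: a nonempty closed walk with pairwise distinct
nodes (apart from the repeated endpoint). -/
def IsCycleIn (G : SubD n) (W : List (Fin n)) : Prop :=
  IsWalkIn G W ∧ 2 ≤ W.length ∧ W.head? = W.getLast? ∧ W.dropLast.Nodup

/-- `W` is a path in `G`: a walk with no repeated node. -/
def IsPathIn (G : SubD n) (W : List (Fin n)) : Prop :=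
  IsWalkIn G W ∧ W.Nodup

/-- `v` is reachable from `u` by a (possibly empty) walk in `G`. -/
def ReachIn (G : SubD n) (u v : Fin n) : Prop :=
  ∃ W, IsWalkIn G W ∧ W.head? = some u ∧ W.getLast? = some v

/-- `u` and `v` lie in the same strongly connected component of `G`. -/
def SccEq (G : SubD n) (u v : Fin n) : Prop := ReachIn G u v ∧ ReachIn G v u

/-- The node set of the s.c.c. of `u` in `G`. -/
def sccOf (G : SubD n) (u : Fin n) : Set (Fin n) := {v | SccEq G u v}

/-- The s.c.c. of `u` in `G`, as a digraph. -/
def sccSub (G : SubD n) (u : Fin n) : SubD n :=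
  ⟨sccOf G u, fun a b => G.edge a b ∧ a ∈ sccOf G u ∧ b ∈ sccOf G u⟩

/-- `H` is a subgraph of `G`. -/
def SubLE (H G : SubD n) : Prop := H.verts ⊆ G.verts ∧ ∀ u v, H.edge u v → G.edge u v

/-- `G` is completely reducible: there are no edges between distinct s.c.c.'s,
i.e. every edge lies inside an s.c.c. -/
def CompletelyReducible (G : SubD n) : Prop := ∀ u v, G.edge u v → ReachIn G v u

/-- `G` has no trivial s.c.c.: every node lies on a cycle of `G`. -/
def NoTrivialScc (G : SubD n) : Prop := ∀ v ∈ G.verts, ∃ W, IsCycleIn G W ∧ v ∈ W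

/-- `A` is irreducible: `𝒟(A)` is strongly connected. -/
def IrreducibleMat (A : MPMat n) : Prop := ∀ i j : Fin n, ReachIn (digr A) i j

/-- `W` is a closed walk at node `v` in `G`. -/
def IsClosedWalkAt (G : SubD n) (v : Fin n) (W : List (Fin n)) : Prop :=
  IsWalkIn G W ∧ W.head? = some v ∧ W.getLast? = some v

/-- The greatest common divisor of a set of naturals (0 for the empty set). -/
def setGcd (S : Set ℕ) : ℕ :=
  sInf {d | (∀ s ∈ S, d ∣ s) ∧ ∀ e, (∀ s ∈ S, e ∣ s) → e ∣ d}

/-- The least common multiple of a set of naturals: the least positive common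
multiple (0 if there is none). -/
def setLcm (S : Set ℕ) : ℕ := sInf {m | 0 < m ∧ ∀ s ∈ S, s ∣ m}

/-- The cyclicity of the s.c.c. of `v` in `G`: the gcd of the lengths of the
closed walks of `G` through `v` (0 if `v` lies on no nonempty closed walk). -/
def sccCyclicity (G : SubD n) (v : Fin n) : ℕ :=
  setGcd {l | 0 < l ∧ ∃ W, IsClosedWalkAt G v W ∧ elen W = l}

/-- The cyclicity of a digraph: the lcm of the cyclicities of its
(nontrivial) s.c.c.'s. -/
def graphCyclicity (G : SubD n) : ℕ :=
  setLcm {c | ∃ v ∈ G.verts, c = sccCyclicity G v ∧ 0 < c}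

/-- The walk `W` has mean weight `m`, i.e. `p(W) = l(W)·m` (finitely). -/
def meanIs (A : MPMat n) (W : List (Fin n)) (m : ℝ) : Prop :=
  walkWeight A W = (((elen W : ℝ) * m : ℝ) : WithBot ℝ)

/-- `lam` is the maximum cycle mean `λ(A)` of `A`: it is the mean of some
cycle of `𝒟(A)` and no cycle has a larger mean.  (Its existence is
equivalent to `𝒟(A)` containing a cycle, i.e. `λ(A) ≠ -∞`.) -/
def IsMaxCycleMean (A : MPMat n) (lam : ℝ) : Prop :=
  (∃ W, IsCycleIn (digr A) W ∧ meanIs A W lam) ∧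
  ∀ W m, IsCycleIn (digr A) W → meanIs A W m → m ≤ lam

/-- The set of critical nodes: nodes on some cycle of mean `λ(A)`. -/
def critNodes (A : MPMat n) (lam : ℝ) : Set (Fin n) :=
  {v | ∃ W, IsCycleIn (digr A) W ∧ meanIs A W lam ∧ v ∈ W}

/-- Critical edges: edges of some cycle of mean `λ(A)`. -/
def critEdges (A : MPMat n) (lam : ℝ) (u v : Fin n) : Prop :=
  ∃ W, IsCycleIn (digr A) W ∧ meanIs A W lam ∧ (u, v) ∈ W.zip W.tail

/-- The critical graph `𝒞(A)`. -/
def critSub (A : MPMat n) (lam : ℝ) : SubD n := ⟨critNodes A lam, critEdges A lam⟩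

/-- Add the real constant `c` to every entry. -/
def shiftMat (A : MPMat n) (c : ℝ) : MPMat n := fun i j => A i j + (c : WithBot ℝ)

/-- The max-plus Kleene star `X^* = I ⊕ X ⊕ X² ⊕ ⋯` (entrywise supremum). -/
def mpStar (X : MPMat n) : MPMat n := fun i j => ⨆ t : ℕ, mpPow X t i j

/-- The matrix `M = (((-λ)⊗A)^{γ(𝒢)})^*` used to define the CSR terms. -/
def csrM (A : MPMat n) (lam : ℝ) (G : SubD n) : MPMat n :=
  mpStar (mpPow (shiftMat A (-lam)) (graphCyclicity G))

/-- The `C` term of the CSR expansion of `A` w.r.t. the subgraph `G`. -/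
def csrC (A : MPMat n) (lam : ℝ) (G : SubD n) : MPMat n :=
  fun i j => if j ∈ G.verts then csrM A lam G i j else ⊥

/-- The `R` term of the CSR expansion of `A` w.r.t. the subgraph `G`. -/
def csrR (A : MPMat n) (lam : ℝ) (G : SubD n) : MPMat n :=
  fun i j => if i ∈ G.verts then csrM A lam G i j else ⊥

/-- The `S` term of the CSR expansion of `A` w.r.t. the subgraph `G`. -/
def csrS (A : MPMat n) (lam : ℝ) (G : SubD n) : MPMat n :=
  fun i j => if G.edge i j then A i j + ((-lam : ℝ) : WithBot ℝ) else ⊥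

/-- The matrix `C S^t R`. -/
def csr (A : MPMat n) (lam : ℝ) (G : SubD n) (t : ℕ) : MPMat n :=
  mpMul (mpMul (csrC A lam G) (mpPow (csrS A lam G) t)) (csrR A lam G)

/-- `G` is a representing subgraph of the critical graph `crit`: a completely
reducible subgraph (with no trivial s.c.c.) such that every s.c.c. of `crit`
contains exactly one s.c.c. of `G`. -/
structure IsRepresenting (crit G : SubD n) : Prop where
  le : SubLE G crit
  compRed : CompletelyReducible G
  noTriv : NoTrivialScc G
  covers : ∀ u ∈ crit.verts, ∃ v ∈ G.verts, SccEq crit u v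
  unique : ∀ v ∈ G.verts, ∀ w ∈ G.verts, SccEq crit v w → SccEq G v w

/-- `B` is subordinate to `A`: obtained from `A` by setting some entries to `-∞`. -/
def Subordinate (B A : MPMat n) : Prop := ∀ i j, B i j = A i j ∨ B i j = ⊥

/-- Set to `-∞` all entries in the rows and columns indexed by `S`. -/
def zeroRC (A : MPMat n) (S : Set (Fin n)) : MPMat n :=
  fun i j => if i ∈ S ∨ j ∈ S then ⊥ else A i j

/-- The Nachtigall scheme: zero out the rows and columns of critical nodes. -/
def bN (A : MPMat n) (lam : ℝ) : MPMat n := zeroRC A (critNodes A lam)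

/-- `V` is a max-balancing of `A`: `V = D⁻¹((-λ(A))⊗A)D` with all entries `≤ 0`,
entries `0` on critical edges, and every edge of `𝒟(V)` lies on a cycle all of
whose edges have weight at least that of the given edge (cycle cover). -/
def IsMaxBalancing (A : MPMat n) (lam : ℝ) (V : MPMat n) : Prop :=
  (∃ d : Fin n → ℝ, ∀ i j, V i j = A i j + ((d j - d i - lam : ℝ) : WithBot ℝ)) ∧
  (∀ i j, V i j ≤ (0 : WithBot ℝ)) ∧
  (∀ i j, critEdges A lam i j → V i j = (0 : WithBot ℝ)) ∧
  (∀ i j, V i j ≠ ⊥ →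
    ∃ W, IsCycleIn (digr V) W ∧ (i, j) ∈ W.zip W.tail ∧ ∀ p ∈ W.zip W.tail, V i j ≤ V p.1 p.2)

/-- The Hartmann-Arguelles threshold graph `Θ^{ha}(μ)`: induced by the edges
with `v_{ij} ≥ μ`; by convention `Θ^{ha}(-∞) = 𝒟(A)`. -/
def thrHA (A V : MPMat n) (μ : WithBot ℝ) : SubD n :=
  if μ = ⊥ then digr A
  else ⟨{u | ∃ w, μ ≤ V u w ∨ μ ≤ V w u}, fun u v => μ ≤ V u v⟩

/-- The cycle threshold graph `Θ^{ct}(μ)`: induced by all nodes and edges of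
cycles of mean weight `≥ μ`; by convention `Θ^{ct}(-∞) = 𝒟(A)`. -/
def thrCT (A : MPMat n) (μ : WithBot ℝ) : SubD n :=
  if μ = ⊥ then digr A
  else ⟨{v | ∃ W m, IsCycleIn (digr A) W ∧ meanIs A W m ∧ μ ≤ (m : WithBot ℝ) ∧ v ∈ W},
        fun u v => ∃ W m, IsCycleIn (digr A) W ∧ meanIs A W m ∧ μ ≤ (m : WithBot ℝ) ∧
          (u, v) ∈ W.zip W.tail⟩

/-- `Θ` has an s.c.c. containing no s.c.c. of `crit`. -/
def HasFreeScc (Θ crit : SubD n) : Prop :=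
  ∃ u ∈ Θ.verts, ¬ ∃ w ∈ crit.verts, sccOf crit w ⊆ sccOf Θ u

/-- `μ` is the greatest value `≤ λ(A)` satisfying `P` (or `-∞` if there is
no such value). -/
def IsThrMax (P : WithBot ℝ → Prop) (lam : ℝ) (μ : WithBot ℝ) : Prop :=
  (μ ≤ (lam : WithBot ℝ) ∧ P μ ∧ ∀ μ', μ' ≤ (lam : WithBot ℝ) → P μ' → μ' ≤ μ) ∨
  (μ = ⊥ ∧ ∀ μ', μ' ≤ (lam : WithBot ℝ) → ¬ P μ')

/-- `μ = μ^{ha}` for the max-balancing `V` of `A`. -/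
def IsMuHA (A : MPMat n) (lam : ℝ) (V : MPMat n) (μ : WithBot ℝ) : Prop :=
  IsThrMax (fun m => HasFreeScc (thrHA A V m) (critSub A lam)) lam μ

/-- `μ = μ^{ct}` for `A`. -/
def IsMuCT (A : MPMat n) (lam : ℝ) (μ : WithBot ℝ) : Prop :=
  IsThrMax (fun m => HasFreeScc (thrCT A m) (critSub A lam)) lam μ

/-- The union of the s.c.c.'s of `Θ` intersecting the node set `crit`. -/
def unionSccMeeting (Θ : SubD n) (crit : Set (Fin n)) : Set (Fin n) :=
  {v | v ∈ Θ.verts ∧ ∃ w ∈ crit, SccEq Θ v w}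

/-- The node set `𝒢^{ha}` of the Hartmann-Arguelles scheme. -/
def haNodes (A V : MPMat n) (lam : ℝ) (μ : WithBot ℝ) : Set (Fin n) :=
  unionSccMeeting (thrHA A V μ) (critNodes A lam)

/-- The matrix `B^{HA}` of the Hartmann-Arguelles scheme. -/
def bHA (A V : MPMat n) (lam : ℝ) (μ : WithBot ℝ) : MPMat n :=
  zeroRC A (haNodes A V lam μ)

/-- The node set `𝒢^{ct}` of the cycle threshold scheme. -/
def ctNodes (A : MPMat n) (lam : ℝ) (μ : WithBot ℝ) : Set (Fin n) :=
  unionSccMeeting (thrCT A μ) (critNodes A lam)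

/-- The matrix `B^{ct}` of the cycle threshold scheme. -/
def bCT (A : MPMat n) (lam : ℝ) (μ : WithBot ℝ) : MPMat n :=
  zeroRC A (ctNodes A lam μ)

/-- The graph `𝒢^{ct}`: the union of the s.c.c.'s of `Θ^{ct}(μ^{ct})`
intersecting `𝒞(A)`, as a digraph. -/
def ctSub (A : MPMat n) (lam : ℝ) (μ : WithBot ℝ) : SubD n :=
  ⟨ctNodes A lam μ,
   fun u v => (thrCT A μ).edge u v ∧ u ∈ ctNodes A lam μ ∧ v ∈ ctNodes A lam μ⟩

/-- The circumference of `G`: the greatest length of a cycle of `G`. -/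
def circumf (G : SubD n) : ℕ := sSup {l | ∃ W, IsCycleIn G W ∧ W.length = l + 1}

/-- The cab driver's diameter of `G`: the greatest length of a path of `G`. -/
def cabDiam (G : SubD n) : ℕ := sSup {l | ∃ W, IsPathIn G W ∧ W.length = l + 1}

/-- The girth of the s.c.c. of `v` in `G`: the least length of a cycle lying
in the s.c.c. of `v`. -/
def sccGirth (G : SubD n) (v : Fin n) : ℕ :=
  sInf {l | 0 < l ∧ ∃ W, IsCycleIn G W ∧ W.length = l + 1 ∧ ∀ u ∈ W, SccEq G v u}

/-- The max-girth of `G`: the greatest girth of an s.c.c. of `G`. -/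
def maxGirth (G : SubD n) : ℕ := sSup {g | ∃ v ∈ G.verts, 0 < g ∧ g = sccGirth G v}

/-- The max-cyclicity of `G`: the greatest cyclicity of an s.c.c. of `G`. -/
def maxCyclicity (G : SubD n) : ℕ := sSup {c | ∃ v ∈ G.verts, 0 < c ∧ c = sccCyclicity G v}

/-- The Wielandt number: `Wi(n) = (n-1)² + 1` for `n > 1`, `Wi(1) = 0`. -/
def wielandt (k : ℕ) : ℕ := if k ≤ 1 then 0 else (k - 1) ^ 2 + 1

/-- The set of finite entries of `A`. -/
def finEntries (A : MPMat n) : Set ℝ := {x | ∃ i j, A i j = (x : WithBot ℝ)}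

/-- The least finite entry of `A`. -/
def minEnt (A : MPMat n) : ℝ := sInf (finEntries A)

/-- The greatest finite entry of `A`. -/
def maxEnt (A : MPMat n) : ℝ := sSup (finEntries A)

/-- `‖A‖`: the difference between the greatest and least finite entries. -/
def matNorm (A : MPMat n) : ℝ := maxEnt A - minEnt A

/-- `n_B`: the size of the smallest square submatrix of `B` containing all
finite entries of `B`. -/
def nB (B : MPMat n) : ℕ := Set.ncard {i | ∃ j, B i j ≠ ⊥ ∨ B j i ≠ ⊥}

/-- `‖v‖`: the difference between the greatest and least entries of `v`. -/
def vecNorm (v : Fin n → ℝ) : ℝ := sSup (Set.range v) - sInf (Set.range v)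

/-- The exploration penalty `ep^γ(i)` (w.r.t. the graph `crit`): the least `T`
such that for every multiple `t` of `γ` with `t ≥ T` there is a closed walk of
length `t` at `i` in `crit`. -/
def epAt (crit : SubD n) (γ : ℕ) (i : Fin n) : ℕ :=
  sInf {T | ∀ t, γ ∣ t → T ≤ t → ∃ W, IsClosedWalkAt crit i W ∧ elen W = t}

/-- The exploration penalty `ep^γ(S)`: the maximum of `ep^γ(i)` over `i ∈ S`. -/
def epOn (crit : SubD n) (γ : ℕ) (S : Set (Fin n)) : ℕ := sSup {e | ∃ i ∈ S, e = epAt crit γ i}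

/-- `ep(𝒞(A))`: the maximum over the s.c.c.'s `𝒞_l` of `crit` of
`ep^{γ(𝒞_l)}(𝒞_l)`. -/
def epCrit (crit : SubD n) : ℕ :=
  sSup {e | ∃ i ∈ crit.verts, e = epAt crit (sccCyclicity crit i) i}

/-- The weak CSR expansion `A^t = λ^{⊗t}⊗(CS^tR) ⊕ B^t` holds at time `t`
(with CSR terms taken w.r.t. the subgraph `G`). -/
def weakCSReq (A B : MPMat n) (lam : ℝ) (G : SubD n) (t : ℕ) : Prop :=
  ∀ i j, mpPow A t i j = max (csr A lam G t i j + (((t : ℝ) * lam : ℝ) : WithBot ℝ)) (mpPow B t i j)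

/-- The domination `λ^{⊗t}⊗(CS^tR) ≥ B^t` holds at time `t`. -/
def T2eq (A B : MPMat n) (lam : ℝ) (G : SubD n) (t : ℕ) : Prop :=
  ∀ i j, mpPow B t i j ≤ csr A lam G t i j + (((t : ℝ) * lam : ℝ) : WithBot ℝ)

/-- The domination `λ^{⊗t}⊗(CS^tRv) ≥ B^t v` holds at time `t`. -/
def T2veq (A B : MPMat n) (lam : ℝ) (G : SubD n) (v : Fin n → ℝ) (t : ℕ) : Prop :=
  ∀ i, mpMulVec (mpPow B t) (fun j => (v j : WithBot ℝ)) i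
      ≤ mpMulVec (csr A lam G t) (fun j => (v j : WithBot ℝ)) i + (((t : ℝ) * lam : ℝ) : WithBot ℝ)

/-- One step of removing a (nonempty) closed subwalk from a walk. -/
def RemoveStep (W V : List (Fin n)) : Prop :=
  ∃ (pre mid post : List (Fin n)) (x : Fin n),
    W = pre ++ x :: mid ++ x :: post ∧ V = pre ++ x :: post

/-- One step of inserting a cycle of `C` into a walk (at an occurrence of a
node of that cycle). -/
def InsertStep (C : SubD n) (W V : List (Fin n)) : Prop :=
  ∃ (pre post mid : List (Fin n)) (x : Fin n),
    W = pre ++ x :: post ∧ V = pre ++ x :: mid ++ x :: post ∧ IsCycleIn C (x :: mid ++ [x])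

/-- `V` is obtained from `W` by removing cycles. -/
def RemOnly : List (Fin n) → List (Fin n) → Prop := Relation.ReflTransGen RemoveStep

/-- `V` is obtained from `W` by removing cycles and possibly inserting cycles
of `C`. -/
def RemIns (C : SubD n) : List (Fin n) → List (Fin n) → Prop :=
  Relation.ReflTransGen fun W V => RemoveStep W V ∨ InsertStep C W V

/-- `V` is obtained from `W` by removing at least one cycle and possibly
inserting cycles of `C`. -/
def RemInsStrict (C : SubD n) (W V : List (Fin n)) : Prop :=
  ∃ W₁ W₂, RemIns C W W₁ ∧ RemoveStep W₁ W₂ ∧ RemIns C W₂ V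

/-- `T` witnesses the cycle removal threshold `T_cr^γ(C) ≤ T` in the digraph
`G`: every walk of `G` through `C` of length `≥ T` can be reduced (removing
cycles, possibly inserting cycles of `C`) to a walk through `C` with the same
endpoints, the same length mod `γ`, and length `≤ T`. -/
def TcrProp (G C : SubD n) (γ T : ℕ) : Prop :=
  ∀ W, IsWalkIn G W → (∃ v ∈ C.verts, v ∈ W) → T ≤ elen W →
    ∃ V, RemIns C W V ∧ IsWalkIn G V ∧ (∃ v ∈ C.verts, v ∈ V) ∧
      V.head? = W.head? ∧ V.getLast? = W.getLast? ∧ elen V ≡ elen W [MOD γ] ∧ elen V ≤ T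

/-- `T` witnesses the strict cycle removal threshold `T̃_cr^γ(C) ≤ T`. -/
def TcrStrictProp (G C : SubD n) (γ T : ℕ) : Prop :=
  ∀ W, IsWalkIn G W → (∃ v ∈ C.verts, v ∈ W) → T ≤ elen W →
    ∃ V, RemInsStrict C W V ∧ IsWalkIn G V ∧ (∃ v ∈ C.verts, v ∈ V) ∧
      V.head? = W.head? ∧ V.getLast? = W.getLast? ∧ elen V ≡ elen W [MOD γ] ∧ elen V ≤ T

/-- The cycle removal threshold `T_cr^γ(C)` of the subgraph `C` in `G`. -/
def Tcr (G C : SubD n) (γ : ℕ) : ℕ := sInf {T | TcrProp G C γ T}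

/-- The strict cycle removal threshold `T̃_cr^γ(C)` of the subgraph `C` in `G`. -/
def TcrStrict (G C : SubD n) (γ : ℕ) : ℕ := sInf {T | TcrStrictProp G C γ T}

/-- The subgraph formed by the nodes and edges of the walk `W`. -/
def cycleSub (W : List (Fin n)) : SubD n :=
  ⟨{v | v ∈ W}, fun a b => (a, b) ∈ W.zip W.tail⟩

/-- The single-node subgraph `{i}` (with no edges). -/
def singleSub (i : Fin n) : SubD n := ⟨{i}, fun _ _ => False⟩

/-- `λ(M)` as an element of `ℝmax` (`-∞` if `𝒟(M)` has no cycle). -/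
def lamW (M : MPMat n) : WithBot ℝ :=
  sSup {x : WithBot ℝ | ∃ W m, IsCycleIn (digr M) W ∧ meanIs M W m ∧ x = (m : WithBot ℝ)}

end MaxPlus

namespace MaxPlus

section helpers
open Classical
variable {n : ℕ}

/-- Walk from `i` to `j`; the list holds the visited nodes after `i`. -/
def Wk (E : Fin n → Fin n → Prop) : Fin n → List (Fin n) → Fin n → Prop
  | i, [], j => i = j
  | i, y :: l, j => E i y ∧ Wk E y l j

/-- Real weight of a walk. -/
def wt (a : Fin n → Fin n → ℝ) : Fin n → List (Fin n) → ℝ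
  | _, [] => 0
  | i, y :: l => a i y + wt a y l

variable {E : Fin n → Fin n → Prop} {a : Fin n → Fin n → ℝ}

theorem Wk_nil {i j : Fin n} : Wk E i [] j ↔ i = j := Iff.rfl
theorem Wk_cons {i y j : Fin n} {l} : Wk E i (y :: l) j ↔ E i y ∧ Wk E y l j := Iff.rfl
theorem wt_nil {i : Fin n} : wt a i [] = 0 := rfl
theorem wt_cons {i y : Fin n} {l} : wt a i (y :: l) = a i y + wt a y l := rfl

theorem Wk_append {i j : Fin n} {l₁ l₂ : List (Fin n)} :
    Wk E i (l₁ ++ l₂) j ↔ ∃ k, Wk E i l₁ k ∧ Wk E k l₂ j := by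
  induction l₁ generalizing i with
  | nil => simp [Wk_nil]
  | cons y l ih => simp [Wk_cons, ih, and_assoc]

theorem Wk.app {i k j : Fin n} {l₁ l₂ : List (Fin n)} (h₁ : Wk E i l₁ k) (h₂ : Wk E k l₂ j) :
    Wk E i (l₁ ++ l₂) j := Wk_append.2 ⟨k, h₁, h₂⟩

theorem Wk.uniq {i k k' : Fin n} {l : List (Fin n)} (h₁ : Wk E i l k) (h₂ : Wk E i l k') :
    k = k' := by
  induction l generalizing i with
  | nil => rw [Wk_nil] at h₁ h₂; rw [← h₁, ← h₂]
  | cons y l ih => exact ih h₁.2 h₂.2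

theorem wt_append {i k : Fin n} {l₁ l₂ : List (Fin n)} (h : Wk E i l₁ k) :
    wt a i (l₁ ++ l₂) = wt a i l₁ + wt a k l₂ := by
  induction l₁ generalizing i with
  | nil => rw [Wk_nil] at h; subst h; simp [wt_nil]
  | cons y l ih => simp only [List.cons_append, wt_cons, ih h.2]; ring

theorem Wk.mono {E' : Fin n → Fin n → Prop} (hE : ∀ x y, E x y → E' x y) {i j : Fin n}
    {l : List (Fin n)} (h : Wk E i l j) : Wk E' i l j := by
  induction l generalizing i with
  | nil => exact h
  | cons y l ih => exact ⟨hE _ _ h.1, ih h.2⟩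

theorem Wk.last_mem {i j : Fin n} {l : List (Fin n)} (h : Wk E i l j) : j ∈ i :: l := by
  induction l generalizing i with
  | nil => rw [Wk_nil] at h; simp [h]
  | cons y l ih => exact List.mem_cons_of_mem _ (ih h.2)

theorem Wk.last_mem' {i j : Fin n} {l : List (Fin n)} (h : Wk E i l j) (hl : l ≠ []) : j ∈ l := by
  cases l with
  | nil => exact absurd rfl hl
  | cons y l => exact h.2.last_mem

theorem Wk.split {i j u : Fin n} {l : List (Fin n)} (h : Wk E i l j) (hu : u ∈ i :: l) :
    ∃ l₁ l₂, l = l₁ ++ l₂ ∧ Wk E i l₁ u ∧ Wk E u l₂ j := by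
  induction l generalizing i with
  | nil =>
    simp at hu; subst hu
    exact ⟨[], [], rfl, rfl, h⟩
  | cons y l ih =>
    rcases List.mem_cons.1 hu with rfl | hu
    · exact ⟨[], y :: l, rfl, rfl, h⟩
    · obtain ⟨l₁, l₂, rfl, h1, h2⟩ := ih h.2 hu
      exact ⟨y :: l₁, l₂, rfl, ⟨h.1, h1⟩, h2⟩

theorem Wk.split_first {i j : Fin n} {l : List (Fin n)} (Z : Finset (Fin n)) (h : Wk E i l j)
    (hu : ∃ x ∈ i :: l, x ∈ Z) :
    ∃ u l₁ l₂, u ∈ Z ∧ l = l₁ ++ l₂ ∧ Wk E i l₁ u ∧ Wk E u l₂ j ∧ ∀ x ∈ i :: l₁, x ∈ Z → x = u := by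
  induction l generalizing i with
  | nil =>
    obtain ⟨x, hx, hz⟩ := hu
    simp at hx; subst hx
    exact ⟨x, [], [], hz, rfl, rfl, h, by simp⟩
  | cons y l ih =>
    by_cases hi : i ∈ Z
    · exact ⟨i, [], y :: l, hi, rfl, rfl, h, by simp⟩
    · obtain ⟨x, hx, hz⟩ := hu
      rcases List.mem_cons.1 hx with rfl | hx
      · exact absurd hz hi
      obtain ⟨u, l₁, l₂, hu, rfl, h1, h2, h3⟩ := ih h.2 ⟨x, hx, hz⟩
      refine ⟨u, y :: l₁, l₂, hu, rfl, ⟨h.1, h1⟩, h2, ?_⟩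
      intro w hw hwz
      rcases List.mem_cons.1 hw with rfl | hw
      · exact absurd hwz hi
      · exact h3 w hw hwz

theorem Wk.dup {S : Finset (Fin n)} {i j : Fin n} {l : List (Fin n)} (h : Wk E i l j)
    (hS : ∀ x ∈ i :: l, x ∈ S) (hd : ¬ (i :: l).Nodup) :
    ∃ l₁ c l₂ k, l = l₁ ++ c ++ l₂ ∧ c ≠ [] ∧ Wk E i l₁ k ∧ Wk E k c k ∧ Wk E k l₂ j ∧
      l₁.length + c.length ≤ S.card := by
  induction l using List.reverseRecOn generalizing j with
  | nil => simp at hd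
  | append_singleton l y ih =>
    obtain ⟨k, h1, h2⟩ := Wk_append.1 h
    have hSl : ∀ x ∈ i :: l, x ∈ S := fun x hx => hS x (by
      rw [← List.cons_append]; exact List.mem_append_left _ hx)
    by_cases hn : (i :: l).Nodup
    · have hy : y ∈ i :: l := by
        by_contra hy
        apply hd
        rw [← List.cons_append]
        rw [List.nodup_append]
        refine ⟨hn, by simp, ?_⟩
        intro x hx z hz
        simp at hz; subst hz
        rintro rfl; exact hy hx
      obtain ⟨l₁, l₂, rfl, h3, h4⟩ := h1.split hy
      have hc : (i :: (l₁ ++ l₂)).length ≤ S.card := by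
        rw [← List.toFinset_card_of_nodup hn]
        apply Finset.card_le_card
        intro x hx; exact hSl x (List.mem_toFinset.1 hx)
      have hyj : y = j := h2.2
      refine ⟨l₁, l₂ ++ [y], [], y, by simp, by simp, h3, h4.app ⟨h2.1, rfl⟩, hyj, ?_⟩
      simp at hc ⊢; omega
    · obtain ⟨l₁, c, l₂, k', rfl, hc, h3, h4, h5, h6⟩ := ih h1 hSl hn
      exact ⟨l₁, c, l₂ ++ [y], k', by simp, hc, h3, h4, h5.app h2, h6⟩

/-- Removable pieces. -/
def Rd (E : Fin n → Fin n → Prop) (a : Fin n → Fin n → ℝ) (i j : Fin n) (l : List (Fin n))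
    (cs : List ℕ) : Prop :=
  ∀ b : List ℕ, b.Sublist cs → ∃ l', Wk E i l' j ∧ l'.length + b.sum = l.length ∧ wt a i l ≤ wt a i l'

theorem Rd.app {i k j : Fin n} {l₁ l₂ : List (Fin n)} {c₁ c₂ : List ℕ} (hk : Wk E i l₁ k)
    (h₁ : Rd E a i k l₁ c₁) (h₂ : Rd E a k j l₂ c₂) : Rd E a i j (l₁ ++ l₂) (c₁ ++ c₂) := by
  intro b hb
  obtain ⟨b₁, b₂, rfl, hb1, hb2⟩ := List.sublist_append_iff.1 hb
  obtain ⟨l₁', w1, s1, t1⟩ := h₁ b₁ hb1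
  obtain ⟨l₂', w2, s2, t2⟩ := h₂ b₂ hb2
  refine ⟨l₁' ++ l₂', w1.app w2, ?_, ?_⟩
  · simp; omega
  · rw [wt_append hk, wt_append w1]; linarith

/-- all closed walks inside `S` have nonpositive weight -/
def NP (E : Fin n → Fin n → Prop) (a : Fin n → Fin n → ℝ) (S : Finset (Fin n)) : Prop :=
  ∀ k c, Wk E k c k → (∀ x ∈ k :: c, x ∈ S) → wt a k c ≤ 0

theorem decomp {S : Finset (Fin n)} (hNP : NP E a S) {i j : Fin n} {l : List (Fin n)}
    (h : Wk E i l j) (hS : ∀ x ∈ i :: l, x ∈ S) :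
    ∃ cs, Rd E a i j l cs ∧ (∀ c ∈ cs, 0 < c) ∧ l.length + 1 ≤ cs.length * S.card + S.card := by
  induction hL : l.length using Nat.strong_induction_on generalizing i l with
  | _ L ih =>
  subst hL
  by_cases hn : (i :: l).Nodup
  · refine ⟨[], ?_, by simp, ?_⟩
    · intro b hb
      simp at hb; subst hb
      exact ⟨l, h, by simp, le_rfl⟩
    · have : (i :: l).length ≤ S.card := by
        rw [← List.toFinset_card_of_nodup hn]
        apply Finset.card_le_card
        intro x hx; exact hS x (List.mem_toFinset.1 hx)
      simp at this ⊢; omega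
  · obtain ⟨l₁, c, l₂, k, rfl, hc, h1, h2, h3, h4⟩ := h.dup hS hn
    have hcl : 0 < c.length := List.length_pos_iff.2 hc
    have hkm : ∀ x ∈ k :: c, x ∈ S := by
      intro x hx
      apply hS
      rcases List.mem_cons.1 hx with rfl | hx
      · rcases List.mem_cons.1 h1.last_mem with hx | hx
        · simp [hx]
        · simp [hx]
      · simp [hx]
    have hkm2 : ∀ x ∈ k :: l₂, x ∈ S := by
      intro x hx
      rcases List.mem_cons.1 hx with rfl | hx
      · exact hkm x (by simp)
      · apply hS; simp [hx]
    obtain ⟨cs, r1, r2, r3⟩ := ih l₂.length (by simp; omega) h3 hkm2 rfl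
    refine ⟨c.length :: cs, ?_, ?_, ?_⟩
    · have : Rd E a i k (l₁ ++ c) [c.length] := by
        intro b hb
        rcases List.sublist_singleton.1 hb with rfl | rfl
        · exact ⟨l₁ ++ c, h1.app h2, by simp, le_rfl⟩
        · refine ⟨l₁, h1, by simp, ?_⟩
          rw [wt_append h1]
          have := hNP k c h2 hkm
          linarith
      exact Rd.app (h1.app h2) this r1
    · intro x hx
      rcases List.mem_cons.1 hx with rfl | hx
      · exact hcl
      · exact r2 x hx
    · simp only [List.length_append, List.length_cons, Nat.add_mul, Nat.one_mul] at *
      omega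

/-- nonpositivity from simple cycles -/
theorem NP_of_cycles {S : Finset (Fin n)}
    (hc : ∀ k c, Wk E k c k → c ≠ [] → c.Nodup → (∀ x ∈ c, x ∈ S) → wt a k c ≤ 0) :
    NP E a S := by
  intro k c h hS
  induction hL : c.length using Nat.strong_induction_on generalizing k c with
  | _ L ih =>
  subst hL
  cases c with
  | nil => simp [wt_nil]
  | cons y l =>
    by_cases hn : (y :: l).Nodup
    · exact hc k _ h (by simp) hn (fun x hx => hS x (List.mem_cons_of_mem _ hx))
    · have hSl : ∀ x ∈ y :: l, x ∈ S := fun x hx => hS x (List.mem_cons_of_mem _ hx)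
      obtain ⟨l₁, c, l₂, k', rfl, hc', h1, h2, h3, h4⟩ := h.2.dup hSl hn
      have hcl : 0 < c.length := List.length_pos_iff.2 hc'
      have hk' : k' ∈ S := by
        rcases List.mem_cons.1 h1.last_mem with hx | hx
        · exact hSl _ (by simp [hx])
        · exact hSl _ (by simp [hx])
      have e1 := ih c.length (by simp; omega) k' c h2 (by
        intro x hx
        rcases List.mem_cons.1 hx with rfl | hx
        · exact hk'
        · exact hSl _ (by simp [hx])) rfl
      have e2 := ih (y :: (l₁ ++ l₂)).length (by simp; omega) k (y :: (l₁ ++ l₂))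
        ⟨h.1, h1.app h3⟩ (by
          intro x hx
          apply hS
          simp at hx ⊢
          tauto) rfl
      rw [wt_cons, wt_append (h1.app h2), wt_append h1]
      rw [wt_cons, wt_append h1] at e2
      linarith

/-- zero-sum consecutive block -/
theorem zero_sum_block {G : Type*} [AddCommGroup G] [Fintype G] (L : List G)
    (h : Fintype.card G ≤ L.length) : ∃ b : List G, b.Sublist L ∧ b ≠ [] ∧ b.sum = 0 := by
  have hcard : Fintype.card G < Fintype.card (Fin (L.length + 1)) := by simp; omega
  obtain ⟨x, y, hne, hxy⟩ := Fintype.exists_ne_map_eq_of_card_lt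
    (fun k : Fin (L.length + 1) => (L.take k).sum) hcard
  wlog hlt : x < y generalizing x y
  · exact this y x hne.symm hxy.symm (lt_of_le_of_ne (not_lt.1 hlt) hne.symm)
  have hlt' : (x : ℕ) < y := hlt
  refine ⟨(L.take y).drop x, (List.drop_sublist _ _).trans (List.take_sublist _ _), ?_, ?_⟩
  · intro h0
    have := congrArg List.length h0
    simp at this
    have := y.2
    omega
  · have := List.sum_take_add_sum_drop (L.take y) x
    rw [List.take_take, min_eq_left hlt'.le] at this
    rw [hxy] at this
    simpa using this

theorem zero_sum_nat (d : ℕ) (hd : 0 < d) (cs : List ℕ) (h : d ≤ cs.length)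
    (hp : ∀ c ∈ cs, 0 < c) : ∃ b : List ℕ, b.Sublist cs ∧ 0 < b.sum ∧ d ∣ b.sum := by
  haveI : NeZero d := ⟨hd.ne'⟩
  obtain ⟨b, hb, hb0, hs⟩ := zero_sum_block (G := ZMod d) (cs.map (fun c : ℕ => (c : ZMod d)))
    (by simpa [ZMod.card] using h)
  obtain ⟨b', hb', rfl⟩ := List.sublist_map_iff.1 hb
  refine ⟨b', hb', ?_, ?_⟩
  · cases b' with
    | nil => simp at hb0
    | cons x r =>
      have := hp x (hb'.subset (by simp))
      simp; omega
  · rw [← ZMod.natCast_eq_zero_iff, ← hs]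
    simp [Nat.cast_list_sum]

/-- one reduction step modulo `d` for a walk through `Z` -/
theorem reduce_step {S Z : Finset (Fin n)} (hNP : NP E a S) {d : ℕ} (hd : 0 < d)
    {i j : Fin n} {l : List (Fin n)} (h : Wk E i l j) (hS : ∀ x ∈ i :: l, x ∈ S)
    (hZ : ∃ x ∈ i :: l, x ∈ Z)
    (hlen : ∀ q₁ q₂, q₁ + q₂ < d →
      q₁ * min S.card (n - Z.card + 1) + min S.card (n - Z.card + 1) +
        (q₂ * S.card + S.card) < l.length + 2) :
    ∃ u l₁ l₂, u ∈ Z ∧ Wk E i l₁ u ∧ Wk E u l₂ j ∧ l₁.length + l₂.length < l.length ∧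
      l₁.length + l₂.length ≡ l.length [MOD d] ∧ wt a i l ≤ wt a i (l₁ ++ l₂) := by
  obtain ⟨u, l₁, l₂, hu, rfl, h1, h2, h3⟩ := h.split_first Z hZ
  have hS1 : ∀ x ∈ i :: l₁, x ∈ S := by
    intro x hx; apply hS; simp at hx ⊢; tauto
  have huS : u ∈ S := hS1 _ h1.last_mem
  have hS2 : ∀ x ∈ u :: l₂, x ∈ S := by
    intro x hx
    rcases List.mem_cons.1 hx with rfl | hx
    · exact huS
    · apply hS; simp [hx]
  set S1 := S ∩ insert u Zᶜ with hS1def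
  have hc1 : S1.card ≤ min S.card (n - Z.card + 1) := by
    refine le_min (Finset.card_le_card Finset.inter_subset_left) ?_
    refine (Finset.card_le_card Finset.inter_subset_right).trans ?_
    refine (Finset.card_insert_le _ _).trans ?_
    rw [Finset.card_compl, Fintype.card_fin]
  have hS1' : ∀ x ∈ i :: l₁, x ∈ S1 := by
    intro x hx
    simp only [hS1def, Finset.mem_inter, Finset.mem_insert, Finset.mem_compl]
    refine ⟨hS1 x hx, ?_⟩
    by_cases hxz : x ∈ Z
    · exact Or.inl (h3 x hx hxz)
    · exact Or.inr hxz
  have hNP1 : NP E a S1 := fun k c hk hkc => hNP k c hk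
    (fun x hx => (Finset.mem_inter.1 (hkc x hx)).1)
  obtain ⟨c₁, r1, p1, b1⟩ := decomp hNP1 h1 hS1'
  obtain ⟨c₂, r2, p2, b2⟩ := decomp hNP h2 hS2
  have hq : d ≤ (c₁ ++ c₂).length := by
    by_contra hq
    have := hlen c₁.length c₂.length (by simpa using hq)
    have h5 : c₁.length * S1.card ≤ c₁.length * min S.card (n - Z.card + 1) :=
      Nat.mul_le_mul_left _ hc1
    simp only [List.length_append] at this
    omega
  obtain ⟨b, hb, hb1, hb2⟩ := zero_sum_nat d hd (c₁ ++ c₂) hq (by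
    intro c hc
    rcases List.mem_append.1 hc with hc | hc
    · exact p1 c hc
    · exact p2 c hc)
  obtain ⟨b₁, b₂, rfl, hb1', hb2'⟩ := List.sublist_append_iff.1 hb
  obtain ⟨l₁', w1, s1, t1⟩ := r1 b₁ hb1'
  obtain ⟨l₂', w2, s2, t2⟩ := r2 b₂ hb2'
  rw [List.sum_append] at hb1 hb2
  refine ⟨u, l₁', l₂', hu, w1, w2, ?_, ?_, ?_⟩
  · simp; omega
  · obtain ⟨q, hq⟩ := hb2
    have : (l₁ ++ l₂).length = l₁'.length + l₂'.length + d * q := by simp; omega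
    rw [this]
    simp [Nat.ModEq]
  · rw [wt_append h1, wt_append w1]; linarith

/-- repeat a closed walk -/
theorem Wk.pump {u : Fin n} {z : List (Fin n)} (h : Wk E u z u) (k : ℕ) :
    ∃ l, Wk E u l u ∧ l.length = k * z.length ∧ wt a u l = k * wt a u z ∧
      (0 < k → ∀ x ∈ z, x ∈ l) := by
  induction k with
  | zero => exact ⟨[], rfl, by simp, by simp [wt_nil], by simp⟩
  | succ k ih =>
    obtain ⟨l, h1, h2, h3, _⟩ := ih
    refine ⟨z ++ l, h.app h1, ?_, ?_, ?_⟩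
    · simp [h2]; ring
    · rw [wt_append h, h3]; push_cast; ring
    · intro _ x hx; simp [hx]

/-- rotate a closed walk -/
theorem Wk.rotate {u v : Fin n} {z : List (Fin n)} (h : Wk E u z u) (hz : z ≠ []) (hv : v ∈ z) :
    ∃ z', Wk E v z' v ∧ z'.length = z.length ∧ wt a v z' = wt a u z ∧ (∀ x, x ∈ z' ↔ x ∈ z) ∧
      (z.Nodup → z'.Nodup) := by
  obtain ⟨l₁, l₂, rfl, h1, h2⟩ := h.split (u := v) (List.mem_cons_of_mem _ hv)
  refine ⟨l₂ ++ l₁, h2.app h1, by simp; omega, ?_, ?_, ?_⟩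
  · rw [wt_append h1, wt_append h2]; ring
  · intro x; simp; tauto
  · intro hn; exact List.nodup_append_comm.1 hn

end helpers

section helpers2
open Classical
variable {n : ℕ} {E : Fin n → Fin n → Prop} {a : Fin n → Fin n → ℝ}

theorem nodup_len_le {z : List (Fin n)} (hz : z.Nodup) : z.length ≤ n := by
  have := hz.length_le_card
  simpa using this

/-- insert copies of a cycle into a walk -/
theorem insert_pump {u i j : Fin n} {z l₁ l₂ : List (Fin n)} (hz : Wk E u z u)
    (h1 : Wk E i l₁ u) (h2 : Wk E u l₂ j) {t : ℕ}
    (hle : l₁.length + l₂.length ≤ t) (hmod : l₁.length + l₂.length ≡ t [MOD z.length]) :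
    ∃ l' k, Wk E i l' j ∧ l'.length = t ∧ wt a i l' = wt a i (l₁ ++ l₂) + (k : ℕ) * wt a u z ∧
      (l₁.length + l₂.length < t → ∀ x ∈ z, x ∈ l') := by
  obtain ⟨k, hk⟩ := (Nat.modEq_iff_dvd' hle).1 hmod
  obtain ⟨p, p1, p2, p3, p4⟩ := hz.pump (a := a) k
  refine ⟨l₁ ++ (p ++ l₂), k, h1.app (p1.app h2), ?_, ?_, ?_⟩
  · simp [p2]; rw [Nat.mul_comm k, ← hk]; omega
  · rw [wt_append h1, wt_append p1, wt_append h1, p3]; ring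
  · intro hlt x hx
    have : 0 < k := by
      rcases Nat.eq_zero_or_pos k with rfl | h
      · simp at hk; omega
      · exact h
    have := p4 this x hx
    simp [this]

theorem aux_q {q₁ q₂ d m s : ℕ} (hq : q₁ + q₂ < d) (hm : m ≤ s) :
    q₁ * m + q₂ * s + s ≤ d * s := by
  have h1 : q₁ * m ≤ q₁ * s := Nat.mul_le_mul_left _ hm
  have h2 : (q₁ + q₂ + 1) * s ≤ d * s := Nat.mul_le_mul_right _ hq
  have h3 : (q₁ + q₂ + 1) * s = q₁ * s + q₂ * s + s := by ring
  omega

theorem ar1 {n d : ℕ} (h : d + 1 ≤ n) : d * n + n ≤ (n - 1) ^ 2 + 1 + d + d := by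
  obtain ⟨e, rfl⟩ : ∃ e, n = d + 1 + e := ⟨n - (d + 1), by omega⟩
  have : d + 1 + e - 1 = d + e := by omega
  rw [this]
  nlinarith [Nat.zero_le (d * e), Nat.zero_le (e * e), Nat.le_mul_self e]

theorem ar2 {n : ℕ} (h : 2 ≤ n) : 2 * n ≤ (n - 1) ^ 2 + 1 + 2 := by
  obtain ⟨e, rfl⟩ : ∃ e, n = e + 2 := ⟨n - 2, by omega⟩
  have : e + 2 - 1 = e + 1 := by omega
  rw [this]; nlinarith

theorem ar3 {n s : ℕ} (h : s + 2 ≤ n) : n * s + 1 ≤ (n - 1) ^ 2 + 1 + 1 := by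
  obtain ⟨e, rfl⟩ : ∃ e, n = s + 2 + e := ⟨n - (s + 2), by omega⟩
  have : s + 2 + e - 1 = s + 1 + e := by omega
  rw [this]; nlinarith [Nat.zero_le (s * e), Nat.zero_le (e * e)]

theorem ar4 {n d s : ℕ} (h : d + 1 ≤ n) (hs : s + 1 ≤ n) :
    d * s + (n - d + 1) ≤ (n - 1) ^ 2 + 1 + 1 := by
  have h7 : d * s ≤ d * (n - 1) := Nat.mul_le_mul_left _ (by omega)
  obtain ⟨e, rfl⟩ : ∃ e, n = d + 1 + e := ⟨n - (d + 1), by omega⟩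
  have e1 : d + 1 + e - 1 = d + e := by omega
  have e2 : d + 1 + e - d = e + 1 := by omega
  rw [e1] at h7 ⊢; rw [e2]
  nlinarith [Nat.zero_le (d * e), Nat.zero_le (e * e), Nat.le_mul_self e]

theorem thm_dm (hNP : NP E a Finset.univ) {u : Fin n} {z : List (Fin n)} (hz : Wk E u z u)
    (hz0 : z ≠ []) (hzn : z.Nodup) (hzw : wt a u z = 0) (hd : z.length + 1 ≤ n)
    {i j : Fin n} {l : List (Fin n)} (h : Wk E i l j) (hu : ∃ x ∈ i :: l, x ∈ z)
    {t : ℕ} (ht : (n - 1) ^ 2 + 1 ≤ t) (hmod : l.length ≡ t [MOD z.length]) :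
    ∃ l', Wk E i l' j ∧ l'.length = t ∧ wt a i l ≤ wt a i l' := by
  induction hL : l.length using Nat.strong_induction_on generalizing l with
  | _ L ih =>
  subst hL
  have hdp : 0 < z.length := List.length_pos_iff.2 hz0
  by_cases hle : l.length ≤ t
  · obtain ⟨x, hx, hxz⟩ := hu
    obtain ⟨l₁, l₂, rfl, h1, h2⟩ := h.split hx
    obtain ⟨z', w1, w2, w3, w4, w5⟩ := hz.rotate (a := a) hz0 hxz
    obtain ⟨l', k, e1, e2, e3, _⟩ := insert_pump (a := a) w1 h1 h2 (t := t)
      (by simpa using hle) (by rw [w2]; simpa using hmod)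
    refine ⟨l', e1, e2, ?_⟩
    rw [e3, w3, hzw]; simp
  · have hcz : z.toFinset.card = z.length := List.toFinset_card_of_nodup hzn
    have hgap : t + z.length ≤ l.length := by
      have h1 : t ≤ l.length := by omega
      obtain ⟨k, hk⟩ := (Nat.modEq_iff_dvd' h1).1 hmod.symm
      have : 0 < k := by
        rcases Nat.eq_zero_or_pos k with rfl | h
        · simp at hk; omega
        · exact h
      have : z.length * 1 ≤ z.length * k := Nat.mul_le_mul_left _ this
      omega
    obtain ⟨v, l₁, l₂, hv, h1, h2, h3, h4, h5⟩ := reduce_step (Z := z.toFinset) hNP hdp h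
      (fun x _ => Finset.mem_univ x) (by simpa using hu) (by
        intro q₁ q₂ hq
        rw [hcz, Finset.card_univ, Fintype.card_fin]
        have hm : min n (n - z.length + 1) ≤ n := min_le_left _ _
        have hm2 : min n (n - z.length + 1) ≤ n - z.length + 1 := min_le_right _ _
        have := aux_q hq hm
        have key : z.length * n + n ≤ (n - 1) ^ 2 + 1 + z.length + z.length := by
          exact ar1 hd
        omega)
    obtain ⟨l', e1, e2, e3⟩ := ih (l₁ ++ l₂).length (by simpa using h3) (h1.app h2)
      ⟨v, by
        rcases List.mem_cons.1 h1.last_mem with hx | hx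
        · simp [hx]
        · simp [hx], by simpa using hv⟩
      (by rw [List.length_append]; exact h4.trans hmod) rfl
    exact ⟨l', e1, e2, h5.trans e3⟩

theorem step {i j v k : Fin n} {l z c : List (Fin n)} (h : Wk E i l j)
    (ht : (n - 1) ^ 2 + 1 ≤ l.length) (hNP : NP E a (i :: l).toFinset)
    (hz : Wk E v z v) (hz0 : z ≠ []) (hzn : z.Nodup) (hzw : 0 ≤ wt a v z)
    (hmeet : ∃ x ∈ i :: l, x ∈ z)
    (hc : Wk E k c k) (hc0 : c ≠ []) (hcn : c.Nodup) (hcw : 0 ≤ wt a k c)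
    (hdis : ∀ x ∈ c, x ∉ i :: l) :
    ∃ l', Wk E i l' j ∧ l'.length = l.length ∧ wt a i l ≤ wt a i l' ∧ ∀ x ∈ z, x ∈ i :: l' := by
  have hdp : 0 < z.length := List.length_pos_iff.2 hz0
  have hcp : 0 < c.length := List.length_pos_iff.2 hc0
  have hcz : z.toFinset.card = z.length := List.toFinset_card_of_nodup hzn
  have hcc : c.toFinset.card = c.length := List.toFinset_card_of_nodup hcn
  have hzl := nodup_len_le hzn
  have hs : (i :: l).toFinset.card + c.length ≤ n := by
    rw [← hcc, ← Finset.card_union_of_disjoint]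
    · exact (Finset.card_le_univ _).trans (by simp)
    · rw [Finset.disjoint_left]
      intro x hx hx'
      exact hdis x (List.mem_toFinset.1 hx') (List.mem_toFinset.1 hx)
  have hs1 : 0 < (i :: l).toFinset.card := Finset.card_pos.2 ⟨i, by simp⟩
  by_cases hspec : z.length = n ∧ c.length = 1
  · obtain ⟨hzn', hc1⟩ := hspec
    have hall : ∀ x, x ∈ z := by
      intro x
      have : z.toFinset = Finset.univ := by
        rw [← Finset.card_eq_iff_eq_univ, hcz]; simpa using hzn'
      rw [← List.mem_toFinset, this]; simp
    -- loop-erased path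
    obtain ⟨p, hp1, hp2, hp3⟩ : ∃ p, Wk E i p j ∧ p.length + 1 ≤ (i :: l).toFinset.card ∧
        wt a i l ≤ wt a i p := by
      clear ht hmeet hdis
      have hsub : ∀ x ∈ i :: l, x ∈ (i :: l).toFinset := fun x hx => List.mem_toFinset.2 hx
      generalize (i :: l).toFinset = S at *
      induction hL : l.length using Nat.strong_induction_on generalizing l with
      | _ L ih =>
      subst hL
      by_cases hn : (i :: l).Nodup
      · refine ⟨l, h, ?_, le_rfl⟩
        have := List.toFinset_card_of_nodup hn
        rw [List.length_cons] at this
        rw [← this]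
        exact Finset.card_le_card fun x hx => hsub x (List.mem_toFinset.1 hx)
      · obtain ⟨l₁, q, l₂, k', rfl, hq, h1, h2, h3, h4⟩ := h.dup hsub hn
        have hql : 0 < q.length := List.length_pos_iff.2 hq
        obtain ⟨p, e1, e2, e3⟩ := ih (l₁ ++ l₂).length (by simp; omega) (h1.app h3)
          (fun x hx => hsub x (by simp at hx ⊢; tauto)) rfl
        refine ⟨p, e1, e2, le_trans ?_ e3⟩
        rw [wt_append (h1.app h2), wt_append h1, wt_append h1]
        have hk' : k' ∈ S := hsub _ (by
          rcases List.mem_cons.1 h1.last_mem with hx | hx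
          · simp [hx]
          · simp [hx])
        have := hNP k' q h2 (by
          intro x hx
          rcases List.mem_cons.1 hx with rfl | hx
          · exact hk'
          · exact hsub x (by simp [hx]))
        linarith
    obtain ⟨z', w1, w2, w3, w4, w5⟩ := hz.rotate (a := a) hz0 (hall i)
    have hkz : k ∈ i :: z' := by simp [w4, hall]
    obtain ⟨z₁, z₂, rfl, y1, y2⟩ := w1.split hkz
    have hlen : z₁.length + (z₂ ++ p).length ≤ l.length := by
      have e1 : z₁.length + z₂.length = n := by
        rw [List.length_append] at w2; omega
      have : 2 * n ≤ (n - 1) ^ 2 + 1 + 2 := by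
        exact ar2 (by omega)
      simp; omega
    obtain ⟨l', kk, e1, e2, e3, e4⟩ := insert_pump (a := a) hc y1 (y2.app hp1) hlen
      (by rw [hc1]; exact Nat.modEq_one)
    by_cases hlt : z₁.length + (z₂ ++ p).length < l.length
    swap
    · refine ⟨z₁ ++ (z₂ ++ p), y1.app (y2.app hp1), ?_, ?_, ?_⟩
      · rw [List.length_append]; omega
      · rw [← List.append_assoc, wt_append w1, w3]; linarith
      · intro x hx
        have := (w4 x).2 hx
        simp at this ⊢; tauto
    · obtain ⟨pp, p1, p2, p3, p4⟩ := hc.pump (a := a) (l.length - (z₁.length + (z₂ ++ p).length))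
      refine ⟨z₁ ++ (pp ++ (z₂ ++ p)), y1.app (p1.app (y2.app hp1)), ?_, ?_, ?_⟩
      · rw [List.length_append, List.length_append, p2, hc1]; omega
      · rw [wt_append y1, wt_append p1, wt_append y2, p3]
        rw [wt_append y1] at w3
        have : (0:ℝ) ≤ ((l.length - (z₁.length + (z₂ ++ p).length) : ℕ) : ℝ) * wt a k c :=
          mul_nonneg (Nat.cast_nonneg _) hcw
        linarith
      · intro x hx
        have := (w4 x).2 hx
        simp at this ⊢; tauto
  · obtain ⟨u, l₁, l₂, hu, h1, h2, h3, h4, h5⟩ := reduce_step (Z := z.toFinset) hNP hdp h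
      (fun x hx => List.mem_toFinset.2 hx) (by simpa using hmeet) (by
        intro q₁ q₂ hq
        rw [hcz]
        generalize (i :: l).toFinset.card = s at *
        have hm : min s (n - z.length + 1) ≤ s := min_le_left _ _
        have hm2 : min s (n - z.length + 1) ≤ n - z.length + 1 := min_le_right _ _
        have := aux_q hq hm
        have key : z.length * s + (n - z.length + 1) ≤ (n - 1) ^ 2 + 1 + 1 := by
          by_cases hd : z.length = n
          · rw [hd, Nat.sub_self]
            have : 2 ≤ c.length := by
              by_contra hcon
              exact hspec ⟨hd, by omega⟩
            exact ar3 (by omega)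
          · exact ar4 (by omega) (by omega)
        omega)
    obtain ⟨z', w1, w2, w3, w4, w5⟩ := hz.rotate (a := a) hz0 (v := u) (by simpa using hu)
    obtain ⟨l', kk, e1, e2, e3, e4⟩ := insert_pump (a := a) w1 h1 h2 h3.le (by rw [w2]; exact h4)
    refine ⟨l', e1, e2, ?_, ?_⟩
    · rw [e3, w3]
      have : (0:ℝ) ≤ (kk:ℝ) * wt a v z := mul_nonneg (Nat.cast_nonneg _) hzw
      linarith
    · intro x hx
      exact List.mem_cons_of_mem _ (e4 h3 x ((w4 x).2 hx))

end helpers2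

section helpers3
open Classical
variable {n : ℕ} {E : Fin n → Fin n → Prop} {a : Fin n → Fin n → ℝ}

theorem Wk.mono_mem {E' : Fin n → Fin n → Prop} {i j : Fin n} {l : List (Fin n)} (h : Wk E i l j)
    (hE : ∀ x y, x ∈ i :: l → y ∈ i :: l → E x y → E' x y) : Wk E' i l j := by
  induction l generalizing i with
  | nil => exact h
  | cons y l ih =>
    refine ⟨hE _ _ (by simp) (by simp) h.1, ih h.2 ?_⟩
    intro x w hx hw
    exact hE x w (List.mem_cons_of_mem _ hx) (List.mem_cons_of_mem _ hw)

/-- edges compatible with the potentials -/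
def Ez (E : Fin n → Fin n → Prop) (a : Fin n → Fin n → ℝ) (f : Fin n → ZMod n) (φ : Fin n → ℝ)
    (x y : Fin n) : Prop := E x y ∧ f y = f x + 1 ∧ φ y = φ x + a x y

theorem Ez_len {f : Fin n → ZMod n} {φ : Fin n → ℝ} {i j : Fin n} {l : List (Fin n)}
    (h : Wk (Ez E a f φ) i l j) : (l.length : ZMod n) = f j - f i ∧ wt a i l = φ j - φ i := by
  induction l generalizing i with
  | nil => rw [Wk_nil] at h; subst h; simp [wt_nil]
  | cons y l ih =>
    obtain ⟨h1, h2⟩ := ih h.2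
    obtain ⟨-, e1, e2⟩ := h.1
    constructor
    · simp only [List.length_cons, Nat.cast_add, Nat.cast_one, h1, e1]; ring
    · rw [wt_cons, h2, e2]; ring

theorem pot_path {v w : Fin n} {l : List (Fin n)} (h : Wk E v l w) (hn : (v :: l).Nodup)
    (f0 : ZMod n) (φ0 : ℝ) :
    ∃ f φ, f v = f0 ∧ φ v = φ0 ∧ Wk (Ez E a f φ) v l w := by
  induction l generalizing v f0 φ0 with
  | nil => exact ⟨fun _ => f0, fun _ => φ0, rfl, rfl, h⟩
  | cons y l ih =>
    obtain ⟨hv, hn'⟩ := List.nodup_cons.1 hn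
    obtain ⟨f, φ, e1, e2, e3⟩ := ih h.2 hn' (f0 + 1) (φ0 + a v y)
    have hne : ∀ x ∈ y :: l, x ≠ v := by rintro x hx rfl; exact hv hx
    refine ⟨Function.update f v f0, Function.update φ v φ0, by simp, by simp, ⟨h.1, ?_, ?_⟩, ?_⟩
    · rw [Function.update_of_ne (hne y (by simp)), e1]; simp
    · rw [Function.update_of_ne (hne y (by simp)), e2]; simp
    · refine e3.mono_mem ?_
      intro x x' hx hx' hh
      rw [Ez, Function.update_of_ne (hne x hx), Function.update_of_ne (hne x' hx'),
        Function.update_of_ne (hne x hx), Function.update_of_ne (hne x' hx')]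
      exact hh

theorem pot_cycle {u : Fin n} {z : List (Fin n)} (hz : Wk E u z u) (hz0 : z ≠ [])
    (hzn : z.Nodup) (hzw : wt a u z = 0) (hd : z.length = n) :
    ∃ f φ, Wk (Ez E a f φ) u z u := by
  rcases List.eq_nil_or_concat z with rfl | ⟨l, y, rfl⟩
  · exact absurd rfl hz0
  rw [List.concat_eq_append] at *
  obtain ⟨w, h1, h2⟩ := Wk_append.1 hz
  have hy : y = u := h2.2
  subst hy
  have hn : (y :: l).Nodup := by
    rw [List.nodup_append] at hzn
    rw [List.nodup_cons]
    exact ⟨fun hm => hzn.2.2 y hm y (by simp) rfl, hzn.1⟩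
  obtain ⟨f, φ, e1, e2, e3⟩ := pot_path (a := a) h1 hn 0 0
  refine ⟨f, φ, e3.app ⟨⟨h2.1, ?_, ?_⟩, rfl⟩⟩
  · obtain ⟨g1, g2⟩ := Ez_len e3
    have : (l.length : ZMod n) + 1 = 0 := by
      have : ((l.length + 1 : ℕ) : ZMod n) = 0 := by
        rw [ZMod.natCast_eq_zero_iff]
        simp at hd; rw [hd]
      simpa using this
    rw [e1]; rw [e1] at g1
    rw [g1] at this; simpa using this.symm
  · obtain ⟨g1, g2⟩ := Ez_len e3
    rw [wt_append h1, g2, wt_cons, wt_nil] at hzw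
    linarith

theorem zsf_eq {G : Type*} [AddCommGroup G] [Fintype G] (x y : G) (L : List G)
    (hc : Fintype.card G = L.length + 3)
    (hz : ∀ b : List G, b.Sublist (x :: y :: L) → b ≠ [] → b.sum ≠ 0) : x = y := by
  set M := x :: y :: L with hM
  have hinj : Function.Injective (fun k : Fin (L.length + 3) => (M.take k).sum) := by
    intro p q hpq
    by_contra hne
    wlog hlt : p < q generalizing p q
    · exact this hpq.symm (Ne.symm hne) (lt_of_le_of_ne (not_lt.1 hlt) (Ne.symm hne))
    have hlt' : (p : ℕ) < q := hlt
    refine hz ((M.take q).drop p) ((List.drop_sublist _ _).trans (List.take_sublist _ _)) ?_ ?_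
    · intro h0
      have := congrArg List.length h0
      simp [hM] at this
      have := q.2
      omega
    · have := List.sum_take_add_sum_drop (M.take q) p
      rw [List.take_take, min_eq_left hlt'.le] at this
      simp only at hpq
      rw [hpq] at this
      simpa using this
  have hbij := (Fintype.bijective_iff_injective_and_card
    (fun k : Fin (L.length + 3) => (M.take k).sum)).2 ⟨hinj, by simp [hc]⟩
  obtain ⟨⟨k, hk⟩, hk'⟩ := hbij.2 y
  simp only at hk'
  match k, hk' with
  | 0, hk' => exact absurd (by simpa using hk'.symm) (hz [y] (by simp [hM]) (by simp))
  | 1, hk' => simpa [hM] using hk'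
  | k + 2, hk' =>
    simp [hM] at hk'
    refine absurd ?_ (hz (x :: L.take k) ?_ (by simp))
    · have h2 : x + (L.take k).sum + y = 0 + y := by
        rw [zero_add]; refine Eq.trans ?_ hk'; abel
      simpa using h2
    · exact ((List.take_sublist _ _).cons y).cons_cons x

/-- edge list of a walk -/
def eds : Fin n → List (Fin n) → List (Fin n × Fin n)
  | _, [] => []
  | i, y :: l => (i, y) :: eds y l

theorem eds_E {i j : Fin n} {l : List (Fin n)} (h : Wk E i l j) : ∀ e ∈ eds i l, E e.1 e.2 := by
  induction l generalizing i with
  | nil => simp [eds]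
  | cons y l ih =>
    intro e he
    rcases List.mem_cons.1 he with rfl | he
    · exact h.1
    · exact ih h.2 e he

theorem eds_sum {f : Fin n → ZMod n} {φ : Fin n → ℝ} {i j : Fin n} {l : List (Fin n)}
    (h : Wk E i l j) :
    (l.length : ZMod n) = f j - f i + ((eds i l).map fun e => 1 + f e.1 - f e.2).sum ∧
    wt a i l = φ j - φ i + ((eds i l).map fun e => a e.1 e.2 + φ e.1 - φ e.2).sum := by
  induction l generalizing i with
  | nil => rw [Wk_nil] at h; subst h; simp [wt_nil, eds]
  | cons y l ih =>
    obtain ⟨h1, h2⟩ := ih h.2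
    simp only [eds, List.map_cons, List.sum_cons, List.length_cons, wt_cons]
    rw [h2]; push_cast; rw [h1]
    constructor <;> ring

theorem assemble {f : Fin n → ZMod n} {φ : Fin n → ℝ}
    (hrun : ∀ x y, ∃ l, Wk E x l y ∧ l.length + 1 ≤ n ∧ (l.length : ZMod n) = f y - f x ∧
      wt a x l = φ y - φ x) (T : List (Fin n × Fin n)) (hT : ∀ e ∈ T, E e.1 e.2) (i j : Fin n) :
    ∃ l, Wk E i l j ∧ l.length + 1 ≤ (T.length + 1) * n ∧
      (l.length : ZMod n) = f j - f i + (T.map fun e => 1 + f e.1 - f e.2).sum ∧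
      wt a i l = φ j - φ i + (T.map fun e => a e.1 e.2 + φ e.1 - φ e.2).sum := by
  induction T generalizing i with
  | nil =>
    obtain ⟨l, h1, h2, h3, h4⟩ := hrun i j
    exact ⟨l, h1, by simpa using h2, by simpa using h3, by simpa using h4⟩
  | cons e T ih =>
    obtain ⟨l, h1, h2, h3, h4⟩ := hrun i e.1
    obtain ⟨l', g1, g2, g3, g4⟩ := ih (fun e' he' => hT e' (List.mem_cons_of_mem _ he')) e.2
    refine ⟨l ++ e.2 :: l', h1.app ⟨hT e (by simp), g1⟩, ?_, ?_, ?_⟩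
    · simp only [List.length_append, List.length_cons]
      have : (T.length + 1 + 1) * n = (T.length + 1) * n + n := by ring
      omega
    · simp only [List.length_append, List.length_cons, List.map_cons, List.sum_cons]
      push_cast; rw [h3, g3]; ring
    · rw [wt_append h1, wt_cons, h4, g4]
      simp only [List.map_cons, List.sum_cons]; ring

theorem sum_le_of_all {T : List (Fin n × Fin n)} {b : Fin n × Fin n → ℝ} {c : ℝ}
    (h : ∀ e ∈ T, b e ≤ c) : (T.map b).sum ≤ T.length * c := by
  induction T with
  | nil => simp
  | cons e T ih =>
    have h1 := ih (fun e' he' => h e' (List.mem_cons_of_mem _ he'))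
    have h2 := h e (by simp)
    simp only [List.map_cons, List.sum_cons, List.length_cons]
    push_cast; linarith

theorem sum_eq_of_all {T : List (Fin n × Fin n)} {s : Fin n × Fin n → ZMod n} {c : ZMod n}
    (h : ∀ e ∈ T, s e = c) : (T.map s).sum = T.length * c := by
  induction T with
  | nil => simp
  | cons e T ih =>
    have h1 := ih (fun e' he' => h e' (List.mem_cons_of_mem _ he'))
    have h2 := h e (by simp)
    simp only [List.map_cons, List.sum_cons, List.length_cons]
    push_cast; rw [h1, h2]; ring

theorem ham_short (hn : 0 < n) {f : Fin n → ZMod n} {φ : Fin n → ℝ}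
    (hrun : ∀ x y, ∃ l, Wk E x l y ∧ l.length + 1 ≤ n ∧ (l.length : ZMod n) = f y - f x ∧
      wt a x l = φ y - φ x) (hneg : ∀ x y, E x y → a x y + φ x - φ y ≤ 0)
    {i j : Fin n} {l : List (Fin n)} (h : Wk E i l j) :
    ∃ l', Wk E i l' j ∧ l'.length < wielandt n + n ∧ (l'.length : ZMod n) = l.length ∧
      wt a i l ≤ wt a i l' := by
  haveI : NeZero n := ⟨hn.ne'⟩
  set s : Fin n × Fin n → ZMod n := fun e => 1 + f e.1 - f e.2 with hs
  set b : Fin n × Fin n → ℝ := fun e => a e.1 e.2 + φ e.1 - φ e.2 with hb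
  obtain ⟨k1, k2⟩ := eds_sum (a := a) (f := f) (φ := φ) h
  let P : ℕ → Prop := fun m => ∃ T : List (Fin n × Fin n), T.length = m ∧ (∀ e ∈ T, E e.1 e.2) ∧
    (T.map s).sum = ((eds i l).map s).sum ∧ ((eds i l).map b).sum ≤ (T.map b).sum
  have hP : ∃ m, P m := ⟨_, eds i l, rfl, eds_E h, rfl, le_rfl⟩
  obtain ⟨T, hTl, hTE, hTs, hTb⟩ := Nat.find_spec hP
  have hmin : ∀ T' : List (Fin n × Fin n), (∀ e ∈ T', E e.1 e.2) →
      (T'.map s).sum = ((eds i l).map s).sum → ((eds i l).map b).sum ≤ (T'.map b).sum →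
      T.length ≤ T'.length := by
    intro T' h1 h2 h3
    rw [hTl]; exact Nat.find_min' hP ⟨T', rfl, h1, h2, h3⟩
  clear hTl
  have hzsf : ∀ T' : List (Fin n × Fin n), T'.Perm T → ∀ c : List (ZMod n),
      c.Sublist (T'.map s) → c ≠ [] → c.sum ≠ 0 := by
    intro T' hp c hc hc0 hcs
    obtain ⟨c', hc', rfl⟩ := List.sublist_map_iff.1 hc
    obtain ⟨r, hr⟩ := hc'.exists_perm_append
    have hr2 : T.Perm (c' ++ r) := hp.symm.trans hr
    have hcl : 0 < c'.length := by
      rw [List.length_pos_iff]; rintro rfl; simp at hc0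
    have e1 := (hr2.map s).sum_eq
    have e2 := (hr2.map b).sum_eq
    rw [List.map_append, List.sum_append] at e1 e2
    have hcn : (c'.map b).sum ≤ c'.length * 0 := sum_le_of_all (fun e he =>
      hneg _ _ (hTE e (hr2.mem_iff.2 (by simp [he]))))
    have := hmin r (fun e he => hTE e (hr2.mem_iff.2 (by simp [he])))
      (by rw [← hTs, e1, hcs, zero_add]) (by rw [e2] at hTb; linarith)
    have := hr2.length_eq
    simp at this
    omega
  have hTn : T.length < n := by
    by_contra hcon
    obtain ⟨c, hc, hc0, hcs⟩ := zero_sum_block (G := ZMod n) (T.map s)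
      (by simpa [ZMod.card] using hcon)
    exact hzsf T (List.Perm.refl _) c hc hc0 hcs
  by_cases hT2 : T.length + 2 ≤ n ∨ T.length = 0
  · obtain ⟨l', e1, e2, e3, e4⟩ := assemble hrun T hTE i j
    refine ⟨l', e1, ?_, ?_, ?_⟩
    · by_cases h1 : n ≤ 1
      · have h1 : n = 1 := by omega
        have : T.length = 0 := by omega
        rw [this] at e2
        have h9 : 0 < wielandt n + n := by omega
        rw [wielandt, if_pos (by omega)]; omega
      · rw [wielandt, if_neg h1]
        have h3 : (T.length + 1) * n ≤ (n - 1) * n := Nat.mul_le_mul_right _ (by omega)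
        obtain ⟨m, rfl⟩ : ∃ m, n = m + 1 := ⟨n - 1, by omega⟩
        simp only [Nat.add_sub_cancel] at *
        nlinarith
    · rw [e3, k1, hTs]
    · rw [e4, k2]; linarith
  · push Not at hT2
    obtain ⟨hT3, hT4⟩ := hT2
    have hTl : T.length + 1 = n := by omega
    obtain ⟨e, heT, hemax⟩ : ∃ e ∈ T, ∀ e' ∈ T, b e' ≤ b e := by
      have hne : T.toFinset.Nonempty := by
        rw [List.toFinset_nonempty_iff]; rintro rfl; simp at hT4
      obtain ⟨e, he, hm⟩ := Finset.exists_max_image T.toFinset b hne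
      exact ⟨e, List.mem_toFinset.1 he, fun e' he' => hm e' (List.mem_toFinset.2 he')⟩
    have hall : ∀ e' ∈ T, s e' = s e := by
      intro e' he'
      have hp1 := List.perm_cons_erase heT
      rcases List.mem_cons.1 (hp1.mem_iff.1 he') with rfl | he2
      · rfl
      · have hp2 := List.perm_cons_erase he2
        have hp3 : T.Perm (e :: e' :: (T.erase e).erase e') := hp1.trans (hp2.cons e)
        have hlen := hp3.length_eq
        symm
        apply zsf_eq (s e) (s e') (((T.erase e).erase e').map s)
        · rw [ZMod.card]; simp at hlen ⊢; omega
        · exact hzsf _ hp3.symm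
    have hs0 : s e ≠ 0 := by
      have := hzsf T (List.Perm.refl _) [s e] (by
        rw [List.singleton_sublist]; exact List.mem_map_of_mem heT) (by simp)
      simpa using this
    have hsum := sum_eq_of_all hall
    have hbsum := sum_le_of_all hemax
    obtain ⟨x, y⟩ := e
    have hexy : E x y := hTE _ heT
    obtain ⟨r1, a1, a2, a3, a4⟩ := hrun i x
    obtain ⟨r2, b1, b2, b3, b4⟩ := hrun y x
    obtain ⟨r3, c1, c2, c3, c4⟩ := hrun y j
    have hr2 : r2.length + 2 ≤ n := by
      by_contra hcon
      apply hs0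
      have h1 : r2.length + 1 = n := by omega
      have h2 : ((r2.length + 1 : ℕ) : ZMod n) = 0 := by rw [h1]; simp
      push_cast at h2
      rw [b3] at h2
      simp only [hs]; rw [← h2]; ring
    have hcl : Wk E x (y :: r2) x := ⟨hexy, b1⟩
    obtain ⟨p, p1, p2, p3, -⟩ := hcl.pump (a := a) (n - 2)
    refine ⟨r1 ++ (p ++ (y :: r3)), a1.app (p1.app ⟨hexy, c1⟩), ?_, ?_, ?_⟩
    · have h1 : (y :: r2).length ≤ n - 1 := by simp; omega
      have h2 : (n - 2) * (y :: r2).length ≤ (n - 2) * (n - 1) := Nat.mul_le_mul_left _ h1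
      rw [← p2] at h2
      rw [wielandt, if_neg (by omega)]
      simp only [List.length_append, List.length_cons]
      obtain ⟨m, rfl⟩ : ∃ m, n = m + 2 := ⟨n - 2, by omega⟩
      have e1 : m + 2 - 2 = m := by omega
      have e2 : m + 2 - 1 = m + 1 := by omega
      rw [e1, e2] at h2
      rw [e2]
      nlinarith
    · rw [k1, ← hTs, hsum]
      simp only [List.length_append, List.length_cons, p2]
      push_cast
      rw [a3, b3, c3]
      have h5 : ((n - 2 : ℕ) : ZMod n) = (T.length : ZMod n) - 1 := by
        have : T.length = (n - 2) + 1 := by omega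
        rw [this]; push_cast; ring
      rw [h5]
      simp only [hs]; ring
    · rw [k2]
      rw [wt_append a1, wt_append p1, p3, wt_cons, wt_cons, a4, b4, c4]
      have h5 : ((n - 2 : ℕ) : ℝ) = (T.length : ℝ) - 1 := by
        have : T.length = (n - 2) + 1 := by omega
        rw [this]; push_cast; ring
      rw [h5]
      have h6 := hTb.trans hbsum
      simp only [hb] at h6 ⊢
      nlinarith

theorem thm_ham (hNP : NP E a Finset.univ) {u : Fin n} {z : List (Fin n)} (hz : Wk E u z u)
    (hz0 : z ≠ []) (hzn : z.Nodup) (hzw : wt a u z = 0) (hd : z.length = n)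
    {i j : Fin n} {l : List (Fin n)} (h : Wk E i l j)
    {t : ℕ} (ht : wielandt n ≤ t) (hmod : l.length ≡ t [MOD z.length]) :
    ∃ l', Wk E i l' j ∧ l'.length = t ∧ wt a i l ≤ wt a i l' := by
  have hn : 0 < n := by rw [← hd]; exact List.length_pos_iff.2 hz0
  have hall : ∀ x, x ∈ z := by
    intro x
    have : z.toFinset = Finset.univ := by
      rw [← Finset.card_eq_iff_eq_univ, List.toFinset_card_of_nodup hzn]; simpa using hd
    rw [← List.mem_toFinset, this]; simp
  obtain ⟨f, φ, hf⟩ := pot_cycle hz hz0 hzn hzw hd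
  have hEz : ∀ x y, Ez E a f φ x y → E x y := fun x y h => h.1
  have hrun : ∀ x y, ∃ l, Wk E x l y ∧ l.length + 1 ≤ n ∧ (l.length : ZMod n) = f y - f x ∧
      wt a x l = φ y - φ x := by
    intro x y
    by_cases hxy : x = y
    · subst hxy; exact ⟨[], rfl, by simp; omega, by simp, by simp [wt_nil]⟩
    · obtain ⟨z', w1, w2, w3, w4, w5⟩ := hf.rotate (a := a) hz0 (hall x)
      obtain ⟨l₁, l₂, rfl, g1, g2⟩ := w1.split (u := y) (List.mem_cons_of_mem _ ((w4 y).2 (hall y)))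
      obtain ⟨q1, q2⟩ := Ez_len g1
      refine ⟨l₁, g1.mono hEz, ?_, q1, q2⟩
      have : 0 < l₂.length := by
        rw [List.length_pos_iff]; rintro rfl
        exact hxy g2.symm
      rw [List.length_append] at w2; omega
  have hneg : ∀ x y, E x y → a x y + φ x - φ y ≤ 0 := by
    intro x y hxy
    obtain ⟨r, r1, r2, r3, r4⟩ := hrun y x
    have := hNP x (y :: r) ⟨hxy, r1⟩ (fun x _ => Finset.mem_univ x)
    rw [wt_cons, r4] at this
    linarith
  obtain ⟨l', e1, e2, e3, e4⟩ := ham_short hn hrun hneg h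
  obtain ⟨z', w1, w2, w3, w4, w5⟩ := hz.rotate (a := a) hz0 (hall i)
  have hm : l'.length ≡ t [MOD n] := by
    rw [hd] at hmod
    exact ((ZMod.natCast_eq_natCast_iff _ _ _).1 e3).trans hmod
  have hle : l'.length ≤ t := by
    by_contra hcon
    have h1 : t ≤ l'.length := by omega
    obtain ⟨k, hk⟩ := (Nat.modEq_iff_dvd' h1).1 hm.symm
    have : 0 < k := by
      rcases Nat.eq_zero_or_pos k with rfl | h
      · simp at hk; omega
      · exact h
    have : n * 1 ≤ n * k := Nat.mul_le_mul_left _ this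
    omega
  obtain ⟨l'', k, y1, y2, y3, _⟩ := insert_pump (a := a) (l₁ := []) (i := i) w1 rfl e1 (t := t)
    (by simpa using hle) (by rw [w2, hd]; simpa using hm)
  refine ⟨l'', y1, y2, ?_⟩
  rw [y3, w3, hzw]; simpa using e4

end helpers3

section helpers4
open Classical
variable {n : ℕ} {E : Fin n → Fin n → Prop} {a : Fin n → Fin n → ℝ} {X : MPMat n}

/-- the matrix `X` is represented by edge relation and real weights -/
def Rep (X : MPMat n) (E : Fin n → Fin n → Prop) (a : Fin n → Fin n → ℝ) : Prop :=
  ∀ x y, (E x y → X x y = ((a x y : ℝ) : WithBot ℝ)) ∧ (¬ E x y → X x y = ⊥)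

theorem pow_ge (hX : Rep X E a) {i j : Fin n} {l : List (Fin n)} (h : Wk E i l j) :
    ((wt a i l : ℝ) : WithBot ℝ) ≤ mpPow X l.length i j := by
  induction l generalizing i with
  | nil => rw [Wk_nil] at h; subst h; simp [wt_nil, mpPow]
  | cons y l ih =>
    simp only [List.length_cons, mpPow, mpMul]
    refine le_trans ?_ (Finset.le_sup (f := fun k => X i k + mpPow X l.length k j)
      (Finset.mem_univ y))
    rw [wt_cons, WithBot.coe_add, (hX i y).1 h.1]
    exact add_le_add le_rfl (ih h.2)

theorem sup_attained {g : Fin n → WithBot ℝ} (h : Finset.univ.sup g ≠ ⊥) :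
    ∃ k, Finset.univ.sup g = g k := by
  have hne : (Finset.univ : Finset (Fin n)).Nonempty := by
    by_contra hcon
    rw [Finset.not_nonempty_iff_eq_empty] at hcon
    rw [hcon] at h; simp at h
  obtain ⟨k, -, hk⟩ := Finset.exists_mem_eq_sup Finset.univ hne g
  exact ⟨k, hk⟩

theorem pow_ex (hX : Rep X E a) {i j : Fin n} {t : ℕ} (h : mpPow X t i j ≠ ⊥) :
    ∃ l, Wk E i l j ∧ l.length = t ∧ mpPow X t i j = ((wt a i l : ℝ) : WithBot ℝ) := by
  induction t generalizing i with
  | zero =>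
    by_cases hij : i = j
    · exact ⟨[], hij, rfl, by simp [mpPow, hij, wt_nil]⟩
    · simp [mpPow, hij] at h
  | succ t ih =>
    obtain ⟨k, hk⟩ := sup_attained (g := fun k => X i k + mpPow X t k j) h
    have hk' : mpPow X (t + 1) i j = X i k + mpPow X t k j := hk
    rw [hk'] at h ⊢
    obtain ⟨h1, h2⟩ : X i k ≠ ⊥ ∧ mpPow X t k j ≠ ⊥ := by
      rwa [← not_or, ← WithBot.add_eq_bot]
    obtain ⟨l, e1, e2, e3⟩ := ih h2
    have hE : E i k := by
      by_contra hcon; exact h1 ((hX i k).2 hcon)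
    exact ⟨k :: l, ⟨hE, e1⟩, by simp [e2], by rw [e3, (hX i k).1 hE, wt_cons, WithBot.coe_add]⟩

theorem pow_pow_ge (hX : Rep X E a) (γ : ℕ) {i j : Fin n} {l : List (Fin n)} {s : ℕ}
    (h : Wk E i l j) (hl : l.length = γ * s) :
    ((wt a i l : ℝ) : WithBot ℝ) ≤ mpPow (mpPow X γ) s i j := by
  induction s generalizing i l with
  | zero =>
    have : l = [] := List.length_eq_zero_iff.1 (by simpa using hl)
    subst this
    rw [Wk_nil] at h; subst h; simp [wt_nil, mpPow]
  | succ s ih =>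
    have hsp : l = l.take γ ++ l.drop γ := (List.take_append_drop _ _).symm
    rw [hsp] at h
    obtain ⟨k, h1, h2⟩ := Wk_append.1 h
    have hmul : γ * (s + 1) = γ * s + γ := by ring
    have hl1 : (l.take γ).length = γ := by simp; omega
    have e1 := pow_ge hX h1
    rw [hl1] at e1
    have e2 := ih h2 (by simp; omega)
    rw [hsp, wt_append h1, WithBot.coe_add]
    refine (add_le_add e1 e2).trans ?_
    exact Finset.le_sup (f := fun k => mpPow X γ i k + mpPow (mpPow X γ) s k j) (Finset.mem_univ k)

theorem pow_pow_ex (hX : Rep X E a) (γ : ℕ) {i j : Fin n} {s : ℕ}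
    (h : mpPow (mpPow X γ) s i j ≠ ⊥) :
    ∃ l, Wk E i l j ∧ l.length = γ * s ∧ mpPow (mpPow X γ) s i j = ((wt a i l : ℝ) : WithBot ℝ) := by
  induction s generalizing i with
  | zero =>
    by_cases hij : i = j
    · exact ⟨[], hij, rfl, by simp [mpPow, hij, wt_nil]⟩
    · simp [mpPow, hij] at h
  | succ t ih =>
    obtain ⟨k, hk⟩ := sup_attained (g := fun k => mpPow X γ i k + mpPow (mpPow X γ) t k j) h
    have hk' : mpPow (mpPow X γ) (t + 1) i j = mpPow X γ i k + mpPow (mpPow X γ) t k j := hk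
    rw [hk'] at h ⊢
    obtain ⟨h1, h2⟩ : mpPow X γ i k ≠ ⊥ ∧ mpPow (mpPow X γ) t k j ≠ ⊥ := by
      rwa [← not_or, ← WithBot.add_eq_bot]
    obtain ⟨l, e1, e2, e3⟩ := ih h2
    obtain ⟨l', g1, g2, g3⟩ := pow_ex hX h1
    refine ⟨l' ++ l, g1.app e1, by simp [e2, g2]; ring, ?_⟩
    rw [e3, g3, wt_append g1, WithBot.coe_add]

theorem iSup_add_le {g : ℕ → WithBot ℝ} {c y : WithBot ℝ} (h : ∀ s, g s + c ≤ y) :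
    (⨆ s, g s) + c ≤ y := by
  induction c with
  | bot => simp
  | coe c =>
    have h1 : ∀ s, g s ≤ y + ((-c : ℝ) : WithBot ℝ) := by
      intro s
      have := add_le_add (h s) (le_refl ((-c : ℝ) : WithBot ℝ))
      rwa [add_assoc, ← WithBot.coe_add, add_neg_cancel, WithBot.coe_zero, add_zero] at this
    have h2 := add_le_add (ciSup_le h1) (le_refl ((c : ℝ) : WithBot ℝ))
    rwa [add_assoc, ← WithBot.coe_add, neg_add_cancel, WithBot.coe_zero, add_zero] at h2

theorem wt_bdd (hNP : NP E a Finset.univ) {i j : Fin n} {l : List (Fin n)} (h : Wk E i l j) :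
    wt a i l ≤ n * ∑ x, ∑ y, |a x y| := by
  induction hL : l.length using Nat.strong_induction_on generalizing l with
  | _ L ih =>
  subst hL
  have hM : ∀ x y, a x y ≤ ∑ x, ∑ y, |a x y| := by
    intro x y
    refine (le_abs_self _).trans ?_
    refine (Finset.single_le_sum (f := fun y => |a x y|) (fun _ _ => abs_nonneg _)
      (Finset.mem_univ y)).trans ?_
    exact Finset.single_le_sum (f := fun x => ∑ y, |a x y|)
      (fun _ _ => Finset.sum_nonneg fun _ _ => abs_nonneg _) (Finset.mem_univ x)
  have hM0 : 0 ≤ ∑ x, ∑ y, |a x y| :=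
    Finset.sum_nonneg fun _ _ => Finset.sum_nonneg fun _ _ => abs_nonneg _
  by_cases hn : (i :: l).Nodup
  · have h1 := nodup_len_le hn
    have h2 : ∀ (l : List (Fin n)) (i : Fin n), wt a i l ≤ l.length * ∑ x, ∑ y, |a x y| := by
      intro l
      induction l with
      | nil => intro i; simp [wt_nil]
      | cons y l ih2 =>
        intro i
        have := ih2 y
        have := hM i y
        rw [wt_cons, List.length_cons]; push_cast; linarith
    refine (h2 l i).trans (mul_le_mul_of_nonneg_right ?_ hM0)
    simp at h1
    exact_mod_cast (by omega : l.length ≤ n)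
  · obtain ⟨l₁, q, l₂, k', rfl, hq, h1, h2, h3, h4⟩ := h.dup (S := Finset.univ)
      (fun x _ => Finset.mem_univ x) hn
    have hql : 0 < q.length := List.length_pos_iff.2 hq
    have := ih (l₁ ++ l₂).length (by simp; omega) (h1.app h3) rfl
    rw [wt_append h1] at this
    rw [wt_append (h1.app h2), wt_append h1]
    have := hNP k' q h2 (fun x _ => Finset.mem_univ x)
    linarith

variable {A : MPMat n} {lam : ℝ} {G : SubD n}

theorem csr_le {EG : Fin n → Fin n → Prop} (hX : Rep (shiftMat A (-lam)) E a) (hS : Rep (csrS A lam G) EG a)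
    {i j : Fin n} {t : ℕ} {y : WithBot ℝ}
    (H : ∀ s₁ s₂ k₁ k₂ l₁ l₂ l₃, k₁ ∈ G.verts → k₂ ∈ G.verts → Wk E i l₁ k₁ →
      l₁.length = graphCyclicity G * s₁ → Wk EG k₁ l₂ k₂ → l₂.length = t → Wk E k₂ l₃ j →
      l₃.length = graphCyclicity G * s₂ →
      ((wt a i l₁ + wt a k₁ l₂ + wt a k₂ l₃ : ℝ) : WithBot ℝ) ≤ y) : csr A lam G t i j ≤ y := by
  simp only [csr, mpMul]
  refine Finset.sup_le fun k₂ _ => ?_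
  by_cases hk2 : k₂ ∈ G.verts
  swap
  · simp [csrR, hk2]
  by_cases hb : (Finset.univ.sup fun k => csrC A lam G i k + mpPow (csrS A lam G) t k k₂) = ⊥
  · rw [hb]; simp
  obtain ⟨k₁, hk⟩ := sup_attained hb
  rw [hk]
  by_cases hk1 : k₁ ∈ G.verts
  swap
  · simp [csrC, hk1]
  simp only [csrC, csrR, hk1, hk2, if_true, csrM, mpStar]
  rw [add_assoc]
  apply iSup_add_le
  intro s₁
  rw [← add_assoc, add_comm]
  apply iSup_add_le
  intro s₂
  by_cases h1 : mpPow (mpPow (shiftMat A (-lam)) (graphCyclicity G)) s₁ i k₁ = ⊥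
  · simp [h1]
  by_cases h2 : mpPow (mpPow (shiftMat A (-lam)) (graphCyclicity G)) s₂ k₂ j = ⊥
  · simp [h2]
  by_cases h3 : mpPow (csrS A lam G) t k₁ k₂ = ⊥
  · simp [h3]
  obtain ⟨l₁, a1, a2, a3⟩ := pow_pow_ex hX _ h1
  obtain ⟨l₃, b1, b2, b3⟩ := pow_pow_ex hX _ h2
  obtain ⟨l₂, c1, c2, c3⟩ := pow_ex hS h3
  rw [a3, b3, c3, ← WithBot.coe_add, ← WithBot.coe_add]
  have := H s₁ s₂ k₁ k₂ l₁ l₂ l₃ hk1 hk2 a1 a2 c1 c2 b1 b2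
  rwa [add_comm (wt a k₂ l₃)]

theorem csrM_ge (hX : Rep (shiftMat A (-lam)) E a) (hNP : NP E a Finset.univ)
    {i j : Fin n} {s : ℕ} {l : List (Fin n)} (h : Wk E i l j)
    (hl : l.length = graphCyclicity G * s) :
    ((wt a i l : ℝ) : WithBot ℝ) ≤ csrM A lam G i j := by
  refine (pow_pow_ge hX _ h hl).trans ?_
  refine le_ciSup (f := fun s => mpPow (mpPow (shiftMat A (-lam)) (graphCyclicity G)) s i j) ?_ s
  refine ⟨((n * ∑ x, ∑ y, |a x y| : ℝ) : WithBot ℝ), ?_⟩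
  rintro _ ⟨s', rfl⟩
  by_cases h1 : mpPow (mpPow (shiftMat A (-lam)) (graphCyclicity G)) s' i j = ⊥
  · simp [h1]
  obtain ⟨l₁, a1, a2, a3⟩ := pow_pow_ex hX _ h1
  simp only
  rw [a3, WithBot.coe_le_coe]
  exact wt_bdd hNP a1

theorem csr_ge {EG : Fin n → Fin n → Prop} (hX : Rep (shiftMat A (-lam)) E a) (hS : Rep (csrS A lam G) EG a)
    (hNP : NP E a Finset.univ)
    {i j : Fin n} {s₁ s₂ : ℕ} {k₁ k₂ : Fin n} {l₁ l₂ l₃ : List (Fin n)} (hk1 : k₁ ∈ G.verts)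
    (hk2 : k₂ ∈ G.verts) (h1 : Wk E i l₁ k₁) (h1' : l₁.length = graphCyclicity G * s₁)
    (h2 : Wk EG k₁ l₂ k₂) (h3 : Wk E k₂ l₃ j) (h3' : l₃.length = graphCyclicity G * s₂) :
    ((wt a i l₁ + wt a k₁ l₂ + wt a k₂ l₃ : ℝ) : WithBot ℝ) ≤ csr A lam G l₂.length i j := by
  have e1 := csrM_ge (G := G) hX hNP h1 h1'
  have e3 := csrM_ge (G := G) hX hNP h3 h3'
  have e2 := pow_ge hS h2
  simp only [csr, mpMul]
  refine le_trans ?_ (Finset.le_sup (f := fun k => (Finset.univ.sup fun k' =>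
    csrC A lam G i k' + mpPow (csrS A lam G) l₂.length k' k) + csrR A lam G k j)
    (Finset.mem_univ k₂))
  rw [WithBot.coe_add]
  refine add_le_add ?_ ?_
  · refine le_trans ?_ (Finset.le_sup (f := fun k' =>
      csrC A lam G i k' + mpPow (csrS A lam G) l₂.length k' k₂) (Finset.mem_univ k₁))
    rw [WithBot.coe_add]
    refine add_le_add ?_ e2
    simpa [csrC, hk1] using e1
  · simpa [csrR, hk2] using e3

end helpers4

section helpers5
open Classical
variable {n : ℕ} {R : Fin n → Fin n → Prop} {A : MPMat n} {lam : ℝ} {G : SubD n}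

/-- edges of a matrix -/
def ED (A : MPMat n) (x y : Fin n) : Prop := A x y ≠ ⊥
/-- real weights of a matrix -/
def ew (A : MPMat n) (x y : Fin n) : ℝ := (A x y).unbotD 0

theorem ew_coe {x y : Fin n} (h : ED A x y) : A x y = ((ew A x y : ℝ) : WithBot ℝ) := by
  unfold ew ED at *
  cases hA : A x y with
  | bot => exact absurd hA h
  | coe c => simp

theorem rep_A : Rep A (ED A) (ew A) := by
  intro x y
  refine ⟨ew_coe, ?_⟩
  intro h; unfold ED at h; push Not at h; exact h

theorem rep_X : Rep (shiftMat A (-lam)) (ED A) (fun x y => ew A x y - lam) := by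
  intro x y
  constructor
  · intro h
    simp only [shiftMat]
    rw [ew_coe h, ← WithBot.coe_add, sub_eq_add_neg]
  · intro h
    simp only [shiftMat]
    rw [(rep_A x y).2 h]; simp

theorem rep_S (h : ∀ x y, G.edge x y → ED A x y) :
    Rep (csrS A lam G) G.edge (fun x y => ew A x y - lam) := by
  intro x y
  constructor
  · intro he
    simp only [csrS, he, if_true]
    rw [ew_coe (h x y he), ← WithBot.coe_add, sub_eq_add_neg]
  · intro he
    simp [csrS, he]

theorem wt_sub (a : Fin n → Fin n → ℝ) (c : ℝ) (i : Fin n) (l : List (Fin n)) :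
    wt (fun x y => a x y - c) i l = wt a i l - l.length * c := by
  induction l generalizing i with
  | nil => simp [wt_nil]
  | cons y l ih => simp only [wt_cons, ih, List.length_cons]; push_cast; ring

theorem wk_of_list {u v : Fin n} {W : List (Fin n)} (hc : W.Chain' R) (hh : W.head? = some u)
    (hl : W.getLast? = some v) : ∃ l, W = u :: l ∧ Wk R u l v := by
  induction W generalizing u with
  | nil => simp at hh
  | cons x W ih =>
    simp at hh; subst hh
    refine ⟨W, rfl, ?_⟩
    cases W with
    | nil => simp at hl; exact hl
    | cons y W =>
      rw [List.Chain', List.isChain_cons_cons] at hc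
      obtain ⟨l, h1, h2⟩ := ih (u := y) hc.2 (by simp) (by simpa using hl)
      simp at h1; subst h1
      exact ⟨hc.1, h2⟩

theorem list_of_wk {u v : Fin n} {l : List (Fin n)} (h : Wk R u l v) :
    (u :: l).Chain' R ∧ (u :: l).getLast? = some v := by
  induction l generalizing u with
  | nil => rw [Wk_nil] at h; subst h; simp [List.Chain']
  | cons y l ih =>
    obtain ⟨h1, h2⟩ := ih h.2
    refine ⟨?_, by simpa using h2⟩
    rw [List.Chain', List.isChain_cons_cons]
    exact ⟨h.1, h1⟩

theorem reach_wk {u v : Fin n} (h : ReachIn G u v) :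
    ∃ l, Wk G.edge u l v ∧ ∀ x ∈ u :: l, x ∈ G.verts := by
  obtain ⟨W, ⟨_, hv, hc⟩, hh, hl⟩ := h
  obtain ⟨l, rfl, h2⟩ := wk_of_list hc hh hl
  exact ⟨l, h2, hv⟩

theorem eds_eq (x : Fin n) (l : List (Fin n)) : eds x l = (x :: l).zip l := by
  induction l generalizing x with
  | nil => simp [eds]
  | cons y l ih => simp [eds, ih y]

theorem eds_split {x y p q : Fin n} {l : List (Fin n)} (h : Wk R x l y) (he : (p, q) ∈ eds x l) :
    ∃ l₁ l₂, l = l₁ ++ q :: l₂ ∧ Wk R x l₁ p ∧ R p q ∧ Wk R q l₂ y := by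
  induction l generalizing x with
  | nil => simp [eds] at he
  | cons w l ih =>
    rcases List.mem_cons.1 he with he | he
    · simp at he; obtain ⟨rfl, rfl⟩ := he
      exact ⟨[], l, rfl, rfl, h.1, h.2⟩
    · obtain ⟨l₁, l₂, rfl, h1, h2, h3⟩ := ih h.2 he
      exact ⟨w :: l₁, l₂, rfl, ⟨h.1, h1⟩, h2, h3⟩

theorem closed_last {x : Fin n} {l : List (Fin n)} (h : Wk R x l x) (hl : l ≠ []) :
    ∃ l', l = l' ++ [x] := by
  rcases List.eq_nil_or_concat l with rfl | ⟨l', y, rfl⟩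
  · exact absurd rfl hl
  · rw [List.concat_eq_append] at *
    obtain ⟨w, h1, h2⟩ := Wk_append.1 h
    have hy : y = x := h2.2
    exact ⟨l', by rw [hy]⟩

theorem cyc_wk {W : List (Fin n)} (h : IsCycleIn G W) :
    ∃ x l, W = x :: l ∧ Wk G.edge x l x ∧ l ≠ [] ∧ l.Nodup ∧ ∀ v ∈ W, v ∈ l := by
  obtain ⟨⟨hne, hv, hc⟩, h2, hh, hd⟩ := h
  cases W with
  | nil => exact absurd rfl hne
  | cons x l =>
    obtain ⟨l', e, hw⟩ := wk_of_list hc (u := x) (v := x) (by simp) (by rw [← hh]; simp)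
    simp at e; subst e
    have hl : l ≠ [] := by rintro rfl; simp at h2
    refine ⟨x, l, rfl, hw, hl, ?_, ?_⟩
    · obtain ⟨l', rfl⟩ := closed_last hw hl
      rw [← List.cons_append, List.dropLast_append_of_ne_nil (by simp)] at hd
      simp at hd ⊢
      rw [List.nodup_append]
      refine ⟨hd.2, by simp, ?_⟩
      intro p hp q hq
      simp at hq; subst hq
      rintro rfl; exact hd.1 hp
    · intro v hv
      rcases List.mem_cons.1 hv with rfl | hv
      · exact hw.last_mem' hl
      · exact hv

theorem wk_cyc {x : Fin n} {l : List (Fin n)} (h : Wk (ED A) x l x) (hl : l ≠ [])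
    (hn : l.Nodup) : IsCycleIn (digr A) (x :: l) := by
  obtain ⟨h1, h2⟩ := list_of_wk h
  refine ⟨⟨by simp, by simp [digr], h1⟩, ?_, ?_, ?_⟩
  · have := List.length_pos_iff.2 hl
    simp; omega
  · rw [h2]; simp
  · obtain ⟨l', rfl⟩ := closed_last h hl
    rw [← List.cons_append, List.dropLast_append_of_ne_nil (by simp)]
    rw [List.nodup_append] at hn
    simp
    exact ⟨fun hm => hn.2.2 x hm x (by simp) rfl, hn.1⟩

theorem ww {x y : Fin n} {l : List (Fin n)} (h : Wk (ED A) x l y) :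
    walkWeight A (x :: l) = ((wt (ew A) x l : ℝ) : WithBot ℝ) := by
  induction l generalizing x with
  | nil => simp [walkWeight, wt_nil]
  | cons w l ih =>
    have := ih h.2
    simp only [walkWeight, List.tail_cons] at this ⊢
    rw [List.zip_cons_cons, List.map_cons, List.sum_cons, this, wt_cons, WithBot.coe_add,
      ew_coe h.1]

/-- cycle of mean `m` -/
def Cyc (A : MPMat n) (m : ℝ) (x : Fin n) (l : List (Fin n)) : Prop :=
  Wk (ED A) x l x ∧ l ≠ [] ∧ l.Nodup ∧ wt (ew A) x l = l.length * m

theorem cyc_of {W : List (Fin n)} {m : ℝ} (h : IsCycleIn (digr A) W) (hm : meanIs A W m) :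
    ∃ x l, W = x :: l ∧ Cyc A m x l ∧ ∀ v ∈ W, v ∈ l := by
  obtain ⟨x, l, rfl, h1, h2, h3, h4⟩ := cyc_wk h
  refine ⟨x, l, rfl, ⟨h1, h2, h3, ?_⟩, h4⟩
  unfold meanIs at hm
  rw [ww h1] at hm
  have := WithBot.coe_injective hm
  simpa [elen] using this

theorem of_cyc {m : ℝ} {x : Fin n} {l : List (Fin n)} (h : Cyc A m x l) :
    IsCycleIn (digr A) (x :: l) ∧ meanIs A (x :: l) m := by
  refine ⟨wk_cyc h.1 h.2.1 h.2.2.1, ?_⟩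
  unfold meanIs
  rw [ww h.1, h.2.2.2]; simp [elen]

theorem Cyc.rot {m : ℝ} {x v : Fin n} {l : List (Fin n)} (h : Cyc A m x l) (hv : v ∈ l) :
    ∃ l', Cyc A m v l' ∧ ∀ y, y ∈ l' ↔ y ∈ l := by
  obtain ⟨z, h1, h2, h3, h4, h5⟩ := h.1.rotate (a := ew A) h.2.1 hv
  refine ⟨z, ⟨h1, ?_, h5 h.2.2.1, by rw [h3, h2, h.2.2.2]⟩, h4⟩
  rintro rfl; simp at h2; exact h.2.1 (List.length_eq_zero_iff.1 h2.symm)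

theorem mem_crit {v : Fin n} : v ∈ critNodes A lam ↔ ∃ l, Cyc A lam v l := by
  constructor
  · rintro ⟨W, h1, h2, h3⟩
    obtain ⟨x, l, rfl, h4, h5⟩ := cyc_of h1 h2
    obtain ⟨l', h6, _⟩ := h4.rot (h5 v h3)
    exact ⟨l', h6⟩
  · rintro ⟨l, h⟩
    exact ⟨v :: l, (of_cyc h).1, (of_cyc h).2, by simp⟩

theorem cyc_mem_crit {x v : Fin n} {l : List (Fin n)} (h : Cyc A lam x l) (hv : v ∈ l) :
    v ∈ critNodes A lam := by
  obtain ⟨l', h', _⟩ := h.rot hv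
  exact mem_crit.2 ⟨l', h'⟩

/-- the shifted weights -/
abbrev aL (A : MPMat n) (lam : ℝ) : Fin n → Fin n → ℝ := fun x y => ew A x y - lam

theorem wt_aL (m : ℝ) (x : Fin n) (l : List (Fin n)) :
    wt (aL A m) x l = wt (ew A) x l - l.length * m := wt_sub _ _ _ _

theorem Cyc.wt0 {m : ℝ} {x : Fin n} {l : List (Fin n)} (h : Cyc A m x l) : wt (aL A m) x l = 0 := by
  rw [wt_aL, h.2.2.2]; ring

theorem crit_edge {u v : Fin n} (h : critEdges A lam u v) :
    ED A u v ∧ (∃ r, Wk (ED A) v r u ∧ aL A lam u v + wt (aL A lam) v r = 0) := by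
  obtain ⟨W, h1, h2, h3⟩ := h
  obtain ⟨x, l, rfl, h4, h5⟩ := cyc_of h1 h2
  rw [List.tail_cons, ← eds_eq] at h3
  obtain ⟨l₁, l₂, rfl, g1, g2, g3⟩ := eds_split h4.1 h3
  refine ⟨g2, l₂ ++ l₁, g3.app g1, ?_⟩
  have := h4.wt0
  rw [wt_append g1, wt_cons] at this
  rw [wt_append g3]
  linarith

theorem crit_ret {i j : Fin n} {l : List (Fin n)} (h : Wk (critEdges A lam) i l j) :
    ∃ r, Wk (ED A) j r i ∧ wt (aL A lam) i l + wt (aL A lam) j r = 0 := by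
  induction l generalizing i with
  | nil => rw [Wk_nil] at h; subst h; exact ⟨[], rfl, by simp [wt_nil]⟩
  | cons y l ih =>
    obtain ⟨r, h1, h2⟩ := ih h.2
    obtain ⟨_, r', h3, h4⟩ := crit_edge h.1
    refine ⟨r ++ r', h1.app h3, ?_⟩
    rw [wt_append h1, wt_cons]; linarith

theorem NP_lam (hlam : IsMaxCycleMean A lam) : NP (ED A) (aL A lam) Finset.univ := by
  apply NP_of_cycles
  intro k c h1 h2 h3 _
  have hl : (0:ℝ) < c.length := by exact_mod_cast List.length_pos_iff.2 h2
  have hC : Cyc A (wt (ew A) k c / c.length) k c := ⟨h1, h2, h3, by field_simp⟩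
  have := hlam.2 _ _ (of_cyc hC).1 (of_cyc hC).2
  rw [div_le_iff₀ hl] at this
  rw [wt_aL]; linarith

theorem crit_closed (hlam : IsMaxCycleMean A lam) {i : Fin n} {l : List (Fin n)}
    (h : Wk (critEdges A lam) i l i) : wt (aL A lam) i l = 0 := by
  obtain ⟨r, h1, h2⟩ := crit_ret h
  have e1 := NP_lam hlam i r h1 (fun x _ => Finset.mem_univ x)
  have e2 := NP_lam hlam i l (h.mono fun x y h => (crit_edge h).1) (fun x _ => Finset.mem_univ x)
  linarith

end helpers5

section helpers6
open Classical
variable {n : ℕ} {A : MPMat n} {lam : ℝ} {G : SubD n}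

theorem setGcd_spec (S : Set ℕ) :
    (∀ s ∈ S, setGcd S ∣ s) ∧ ∀ e, (∀ s ∈ S, e ∣ s) → e ∣ setGcd S := by
  have hne : {d | (∀ s ∈ S, d ∣ s) ∧ ∀ e, (∀ s ∈ S, e ∣ s) → e ∣ d}.Nonempty :=
    ⟨Nat.setGcd S, fun s hs => Nat.setGcd_dvd_of_mem hs, fun e he => Nat.dvd_setGcd_iff.2 he⟩
  exact Nat.sInf_mem hne

theorem setGcd_eq (S : Set ℕ) : setGcd S = Nat.setGcd S :=
  Nat.dvd_antisymm (Nat.dvd_setGcd_iff.2 (setGcd_spec S).1)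
    ((setGcd_spec S).2 _ fun _ hs => Nat.setGcd_dvd_of_mem hs)

theorem edge_verts (hc : CompletelyReducible G) {u v : Fin n} (h : G.edge u v) :
    u ∈ G.verts ∧ v ∈ G.verts := by
  obtain ⟨l, h1, h2⟩ := reach_wk (hc u v h)
  exact ⟨h2 u h1.last_mem, h2 v (by simp)⟩

theorem wk_verts (hc : CompletelyReducible G) {u v : Fin n} {l : List (Fin n)} (hu : u ∈ G.verts)
    (h : Wk G.edge u l v) : ∀ x ∈ u :: l, x ∈ G.verts := by
  induction l generalizing u with
  | nil => simpa using hu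
  | cons y l ih =>
    intro x hx
    rcases List.mem_cons.1 hx with rfl | hx
    · exact hu
    · exact ih (edge_verts hc h.1).2 h.2 x hx

theorem wk_rev (hc : CompletelyReducible G) {u v : Fin n} {l : List (Fin n)}
    (h : Wk G.edge u l v) : ∃ r, Wk G.edge v r u := by
  induction l generalizing u with
  | nil => rw [Wk_nil] at h; subst h; exact ⟨[], rfl⟩
  | cons y l ih =>
    obtain ⟨r, hr⟩ := ih h.2
    obtain ⟨r', hr', _⟩ := reach_wk (hc _ _ h.1)
    exact ⟨r ++ r', hr.app hr'⟩

theorem closed_dvd (hc : CompletelyReducible G) {v : Fin n} {l : List (Fin n)} (hv : v ∈ G.verts)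
    (h : Wk G.edge v l v) : sccCyclicity G v ∣ l.length := by
  rcases Nat.eq_zero_or_pos l.length with h0 | h0
  · rw [h0]; exact dvd_zero _
  · refine (setGcd_spec _).1 _ ⟨h0, v :: l, ⟨⟨by simp, wk_verts hc hv h, (list_of_wk h).1⟩, by simp,
      (list_of_wk h).2⟩, by simp [elen]⟩

theorem cyc_pos (hc : CompletelyReducible G) (hnt : NoTrivialScc G) {v : Fin n} (hv : v ∈ G.verts) :
    0 < sccCyclicity G v ∧ ∃ w, G.edge v w := by
  obtain ⟨W, hW, hvW⟩ := hnt v hv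
  obtain ⟨x, l, rfl, h1, h2, h3, h4⟩ := cyc_wk hW
  obtain ⟨z, e1, e2, -, -, -⟩ := h1.rotate (a := fun _ _ => 0) h2 (h4 v hvW)
  have hl := List.length_pos_iff.2 h2
  constructor
  · exact Nat.pos_of_dvd_of_pos (closed_dvd hc hv e1) (by omega)
  · cases z with
    | nil => simp at e2; omega
    | cons y z => exact ⟨y, e1.1⟩

theorem gam_spec (hc : CompletelyReducible G) (hnt : NoTrivialScc G) :
    0 < graphCyclicity G ∧ ∀ v ∈ G.verts, sccCyclicity G v ∣ graphCyclicity G := by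
  have hne : {m | 0 < m ∧ ∀ s ∈ {c | ∃ v ∈ G.verts, c = sccCyclicity G v ∧ 0 < c}, s ∣ m}.Nonempty := by
    refine ⟨∏ v, (if 0 < sccCyclicity G v then sccCyclicity G v else 1), ?_, ?_⟩
    · apply Finset.prod_pos
      intro v _
      split_ifs with h
      · exact h
      · exact one_pos
    · rintro s ⟨v, hv, rfl, hp⟩
      have := Finset.dvd_prod_of_mem
        (fun v => if 0 < sccCyclicity G v then sccCyclicity G v else 1) (Finset.mem_univ v)
      simpa [hp] using this
  have := Nat.sInf_mem hne
  exact ⟨this.1, fun v hv => this.2 _ ⟨v, hv, rfl, (cyc_pos hc hnt hv).1⟩⟩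

theorem closed_large (v : Fin n) :
    ∃ N, ∀ m, N ≤ m → sccCyclicity G v ∣ m → ∃ c, Wk G.edge v c v ∧ c.length = m := by
  obtain ⟨N, hN⟩ := Nat.exists_mem_closure_of_ge
    {l | 0 < l ∧ ∃ W, IsClosedWalkAt G v W ∧ elen W = l}
  refine ⟨N, fun m hm hd => ?_⟩
  rw [sccCyclicity, setGcd_eq] at hd
  have := hN m hm hd
  clear hm hd
  induction this using AddSubmonoid.closure_induction with
  | mem x hx =>
    obtain ⟨_, W, ⟨⟨_, hv, hc⟩, hh, hl⟩, rfl⟩ := hx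
    obtain ⟨l, rfl, h2⟩ := wk_of_list hc hh hl
    exact ⟨l, h2, by simp [elen]⟩
  | zero => exact ⟨[], rfl, rfl⟩
  | add x y _ _ hx hy =>
    obtain ⟨c, h1, h2⟩ := hx
    obtain ⟨c', h1', h2'⟩ := hy
    exact ⟨c ++ c', h1.app h1', by simp [h2, h2']⟩

theorem out_walk (hc : CompletelyReducible G) (hnt : NoTrivialScc G) (m : ℕ) {v : Fin n}
    (hv : v ∈ G.verts) : ∃ l k, Wk G.edge v l k ∧ l.length = m ∧ k ∈ G.verts := by
  induction m generalizing v with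
  | zero => exact ⟨[], v, rfl, rfl, hv⟩
  | succ m ih =>
    obtain ⟨_, w, hw⟩ := cyc_pos hc hnt hv
    obtain ⟨l, k, h1, h2, h3⟩ := ih (edge_verts hc hw).2
    exact ⟨w :: l, k, ⟨hw, h1⟩, by simp [h2], h3⟩

theorem X_le {i j : Fin n} {t : ℕ} :
    mpPow (shiftMat A (-lam)) t i j + (((t : ℝ) * lam : ℝ) : WithBot ℝ) ≤ mpPow A t i j := by
  by_cases h : mpPow (shiftMat A (-lam)) t i j = ⊥
  · rw [h]; simp
  · obtain ⟨l, h1, h2, h3⟩ := pow_ex rep_X h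
    rw [h3, ← WithBot.coe_add]
    have := pow_ge rep_A h1
    rw [h2] at this
    refine le_trans (le_of_eq ?_) this
    congr 1
    rw [wt_sub, h2]; ring

theorem csr_upper (hlam : IsMaxCycleMean A lam) (hG : IsRepresenting (critSub A lam) G)
    {t : ℕ} (ht : wielandt n ≤ t) (i j : Fin n) :
    csr A lam G t i j + (((t : ℝ) * lam : ℝ) : WithBot ℝ) ≤ mpPow A t i j := by
  have hcE : ∀ x y, G.edge x y → critEdges A lam x y := hG.le.2
  have hE : ∀ x y, G.edge x y → ED A x y := fun x y h => (crit_edge (hcE x y h)).1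
  refine le_trans (add_le_add ?_ le_rfl) X_le
  apply csr_le rep_X (rep_S hE)
  intro s₁ s₂ k₁ k₂ l₁ l₂ l₃ hk1 hk2 h1 h1' h2 h2' h3 h3'
  obtain ⟨hγ, hγd⟩ := gam_spec hG.compRed hG.noTriv
  obtain ⟨z, hz⟩ := mem_crit.1 (hG.le.1 hk1)
  obtain ⟨N, hN⟩ := closed_large (G := G) k₁
  have hd : 0 < z.length := List.length_pos_iff.2 hz.2.1
  obtain ⟨c, hc, hcl⟩ := hN (graphCyclicity G * ((s₁ + s₂) * (z.length - 1) + z.length * N)) (by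
    have : 1 * N ≤ z.length * N := Nat.mul_le_mul_right _ hd
    have h5 : 1 * ((s₁ + s₂) * (z.length - 1) + z.length * N) ≤
      graphCyclicity G * ((s₁ + s₂) * (z.length - 1) + z.length * N) := Nat.mul_le_mul_right _ hγ
    omega) ((hγd k₁ hk1).mul_right _)
  have hc' : wt (aL A lam) k₁ c = 0 := crit_closed hlam (hc.mono hcE)
  have hw : Wk (ED A) i (l₁ ++ (c ++ (l₂ ++ l₃))) j :=
    h1.app ((hc.mono hE).app ((h2.mono hE).app h3))
  have hwt : wt (aL A lam) i (l₁ ++ (c ++ (l₂ ++ l₃))) =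
      wt (aL A lam) i l₁ + wt (aL A lam) k₁ l₂ + wt (aL A lam) k₂ l₃ := by
    rw [wt_append h1, wt_append hc, wt_append h2, hc']; ring
  have hmod : (l₁ ++ (c ++ (l₂ ++ l₃))).length ≡ t [MOD z.length] := by
    have : (l₁ ++ (c ++ (l₂ ++ l₃))).length = t + z.length * (graphCyclicity G * (s₁ + s₂ + N)) := by
      simp only [List.length_append, h1', h2', h3', hcl]
      obtain ⟨d, hd'⟩ : ∃ d, z.length = d + 1 := ⟨z.length - 1, by omega⟩
      rw [hd', Nat.add_sub_cancel]; ring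
    rw [this]; simp [Nat.ModEq]
  have hfin : ∃ l', Wk (ED A) i l' j ∧ l'.length = t ∧
      wt (aL A lam) i (l₁ ++ (c ++ (l₂ ++ l₃))) ≤ wt (aL A lam) i l' := by
    have hzn := nodup_len_le hz.2.2.1
    by_cases hdn : z.length = n
    · exact thm_ham (NP_lam hlam) hz.1 hz.2.1 hz.2.2.1 hz.wt0 hdn hw ht hmod
    · rw [wielandt, if_neg (by omega)] at ht
      refine thm_dm (NP_lam hlam) hz.1 hz.2.1 hz.2.2.1 hz.wt0 (by omega) hw ⟨k₁, ?_, ?_⟩ ht hmod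
      · rw [← List.cons_append]; exact List.mem_append_left _ h1.last_mem
      · exact hz.1.last_mem' hz.2.1
  obtain ⟨l', e1, e2, e3⟩ := hfin
  have := pow_ge (rep_X (lam := lam)) e1
  rw [e2] at this
  refine le_trans ?_ this
  rw [WithBot.coe_le_coe]
  rw [hwt] at e3
  exact e3

theorem csr_lower (hlam : IsMaxCycleMean A lam) (hG : IsRepresenting (critSub A lam) G)
    {i j u : Fin n} {l : List (Fin n)} (h : Wk (ED A) i l j) (hu : u ∈ i :: l)
    (huc : u ∈ critNodes A lam) :
    ((wt (aL A lam) i l : ℝ) : WithBot ℝ) ≤ csr A lam G l.length i j := by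
  have hcE : ∀ x y, G.edge x y → critEdges A lam x y := hG.le.2
  have hE : ∀ x y, G.edge x y → ED A x y := fun x y h => (crit_edge (hcE x y h)).1
  have hcE' : ∀ x y, critEdges A lam x y → ED A x y := fun x y h => (crit_edge h).1
  obtain ⟨hγ, hγd⟩ := gam_spec hG.compRed hG.noTriv
  obtain ⟨v, hv, huv, hvu⟩ := hG.covers u huc
  obtain ⟨p, hp, -⟩ := reach_wk huv
  obtain ⟨q, hq, -⟩ := reach_wk hvu
  change Wk (critEdges A lam) u p v at hp
  change Wk (critEdges A lam) v q u at hq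
  obtain ⟨l₁, l₂, rfl, h1, h2⟩ := h.split hu
  have hpq := hp.app hq
  have hpq0 := crit_closed hlam hpq
  obtain ⟨c₀, c1, c2, c3, -⟩ := hpq.pump (a := aL A lam) (graphCyclicity G - 1)
  have hP : Wk (ED A) i (l₁ ++ p) v := h1.app (hp.mono hcE')
  have hQ : Wk (ED A) v (q ++ (c₀ ++ l₂)) j := (hq.mono hcE').app ((c1.mono hcE').app h2)
  obtain ⟨P, hPdef⟩ : ∃ P, P = l₁ ++ p := ⟨_, rfl⟩
  obtain ⟨Q, hQdef⟩ : ∃ Q, Q = q ++ (c₀ ++ l₂) := ⟨_, rfl⟩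
  have hwt : wt (aL A lam) i P + wt (aL A lam) v Q = wt (aL A lam) i (l₁ ++ l₂) := by
    rw [hPdef, hQdef, wt_append h1, wt_append h1, wt_append hq, wt_append c1, c3, hpq0]
    rw [wt_append hp] at hpq0
    linarith
  have hlen : P.length + Q.length = (l₁ ++ l₂).length + graphCyclicity G * (p ++ q).length := by
    rw [hPdef, hQdef]
    simp only [List.length_append] at c2 ⊢
    rw [c2]
    obtain ⟨g, hg⟩ : ∃ g, graphCyclicity G = g + 1 := ⟨graphCyclicity G - 1, by omega⟩
    rw [hg, Nat.add_sub_cancel]; ring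
  rw [← hPdef] at hP
  rw [← hQdef] at hQ
  clear hPdef hQdef
  obtain ⟨r, k₁, hr, hrl, hk1⟩ := out_walk hG.compRed hG.noTriv (P.length * (graphCyclicity G - 1)) hv
  obtain ⟨T, k₂, hT, hTl, hk2⟩ := out_walk hG.compRed hG.noTriv (l₁ ++ l₂).length hk1
  obtain ⟨g, hg⟩ := wk_rev hG.compRed (hr.app hT)
  obtain ⟨N, hN⟩ := closed_large (G := G) v
  have hPr : P.length + r.length = graphCyclicity G * P.length := by
    rw [hrl]
    obtain ⟨g, hg⟩ : ∃ g, graphCyclicity G = g + 1 := ⟨graphCyclicity G - 1, by omega⟩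
    rw [hg, Nat.add_sub_cancel]; ring
  have hdv : sccCyclicity G v ∣ Q.length + g.length := by
    have d1 := closed_dvd hG.compRed hv ((hr.app hT).app hg)
    have d2 := (hγd v hv).mul_right (p ++ q).length
    have d3 := (hγd v hv).mul_right P.length
    rw [← hPr] at d3
    refine (Nat.dvd_add_right d3).1 ?_
    have : P.length + r.length + (Q.length + g.length) =
        (r ++ T ++ g).length + graphCyclicity G * (p ++ q).length := by
      simp only [List.length_append] at hlen hTl ⊢; omega
    rw [this]
    exact dvd_add d1 d2
  obtain ⟨c, hc, hcl⟩ := hN ((Q.length + g.length) * (graphCyclicity G - 1) + graphCyclicity G * N) (by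
    have : 1 * N ≤ graphCyclicity G * N := Nat.mul_le_mul_right _ hγ
    omega) (dvd_add (hdv.mul_right _) ((hγd v hv).mul_right _))
  have hclosed := crit_closed hlam ((((hr.app hT).app hg).app hc).mono hcE)
  rw [wt_append ((hr.app hT).app hg), wt_append (hr.app hT), wt_append hr] at hclosed
  have key := csr_ge (G := G) (lam := lam) (l₁ := P ++ r) (l₂ := T) (l₃ := g ++ (c ++ Q))
    (s₁ := P.length) (s₂ := Q.length + g.length + N) rep_X (rep_S hE) (NP_lam hlam) hk1 hk2
    (hP.app (hr.mono hE)) (by rw [List.length_append, hPr]) hT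
    ((hg.mono hE).app ((hc.mono hE).app hQ)) (by
      simp only [List.length_append, hcl]
      obtain ⟨g', hg'⟩ : ∃ g, graphCyclicity G = g + 1 := ⟨graphCyclicity G - 1, by omega⟩
      rw [hg', Nat.add_sub_cancel]; ring)
  rw [hTl] at key
  refine le_trans (le_of_eq ?_) key
  congr 1
  rw [wt_append hP, wt_append hg, wt_append hc, ← hwt]
  linarith

end helpers6

section helpers7
open Classical
variable {n : ℕ} {A : MPMat n} {lam : ℝ} {G : SubD n} {μ : WithBot ℝ}

theorem wt_one (i : Fin n) (l : List (Fin n)) : wt (fun _ _ => (1 : ℝ)) i l = l.length := by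
  induction l generalizing i with
  | nil => simp [wt_nil]
  | cons y l ih => rw [wt_cons, ih, List.length_cons]; push_cast; ring

theorem has_cycle {i j : Fin n} {l : List (Fin n)} (h : Wk (ED A) i l j) (hl : n ≤ l.length) :
    ∃ m x c, Cyc A m x c ∧ ∃ y ∈ c, y ∈ i :: l := by
  by_contra hcon
  have hNP : NP (ED A) (fun _ _ => (1 : ℝ)) (i :: l).toFinset := by
    apply NP_of_cycles
    intro k c h1 h2 h3 h4
    exfalso
    apply hcon
    have hl : (c.length : ℝ) ≠ 0 := by
      exact_mod_cast (List.length_pos_iff.2 h2).ne'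
    exact ⟨wt (ew A) k c / c.length, k, c, ⟨h1, h2, h3, by field_simp⟩, k, h1.last_mem' h2,
      List.mem_toFinset.1 (h4 k (h1.last_mem' h2))⟩
  have hd : ¬ (i :: l).Nodup := by
    intro hnd
    have := nodup_len_le hnd
    simp at this; omega
  obtain ⟨l₁, c, l₂, k, rfl, hc, h1, h2, h3, h4⟩ := h.dup (S := Finset.univ)
    (fun x _ => Finset.mem_univ x) hd
  have := hNP k c h2 (by
    intro x hx
    rw [List.mem_toFinset]
    rcases List.mem_cons.1 hx with rfl | hx
    · rcases List.mem_cons.1 h1.last_mem with hx | hx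
      · simp [hx]
      · simp [hx]
    · simp [hx])
  rw [wt_one] at this
  have h5 : (0:ℝ) < c.length := by exact_mod_cast List.length_pos_iff.2 hc
  linarith

theorem means_finite : {m : ℝ | ∃ x c, Cyc A m x c}.Finite := by
  have hf : (Set.univ ×ˢ {c : List (Fin n) | c.length ≤ n}).Finite :=
    (Set.finite_univ (α := Fin n)).prod (List.finite_length_le (Fin n) n)
  refine (hf.image (fun p => wt (ew A) p.1 p.2 / p.2.length)).subset ?_
  rintro m ⟨x, c, h⟩
  refine ⟨(x, c), ⟨Set.mem_univ _, nodup_len_le h.2.2.1⟩, ?_⟩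
  have hl : (c.length : ℝ) ≠ 0 := by
    exact_mod_cast (List.length_pos_iff.2 h.2.1).ne'
  simp only
  rw [h.2.2.2]; field_simp

theorem thr_vert {m : ℝ} {v : Fin n} :
    v ∈ (thrCT A (m : WithBot ℝ)).verts ↔ ∃ m' x c, Cyc A m' x c ∧ m ≤ m' ∧ v ∈ c := by
  simp only [thrCT, WithBot.coe_ne_bot, if_false, Set.mem_setOf_eq, WithBot.coe_le_coe]
  constructor
  · rintro ⟨W, m', h1, h2, h3, h4⟩
    obtain ⟨x, c, rfl, h5, h6⟩ := cyc_of h1 h2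
    exact ⟨m', x, c, h5, h3, h6 v h4⟩
  · rintro ⟨m', x, c, h1, h2, h3⟩
    exact ⟨x :: c, m', (of_cyc h1).1, (of_cyc h1).2, h2, by simp [h3]⟩

theorem thr_edge {m : ℝ} {u v : Fin n} (h : (thrCT A (m : WithBot ℝ)).edge u v) :
    ∃ m' x c, Cyc A m' x c ∧ m ≤ m' ∧ u ∈ c ∧ v ∈ c := by
  simp only [thrCT, WithBot.coe_ne_bot, if_false, WithBot.coe_le_coe] at h
  obtain ⟨W, m', h1, h2, h3, h4⟩ := h
  obtain ⟨x, c, rfl, h5, h6⟩ := cyc_of h1 h2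
  rw [List.tail_cons] at h4
  obtain ⟨g1, g2⟩ := List.of_mem_zip h4
  exact ⟨m', x, c, h5, h3, h6 _ g1, g2⟩

theorem ct_walk (hlam : IsMaxCycleMean A lam) (hμ : IsMuCT A lam μ)
    {i j v : Fin n} {l₀ : List (Fin n)} (h₀ : Wk (ED A) i l₀ j) (ht : wielandt n ≤ l₀.length)
    (hv : v ∈ i :: l₀) (hvc : v ∈ ctNodes A lam μ) :
    ∃ l, Wk (ED A) i l j ∧ l.length = l₀.length ∧ wt (ew A) i l₀ ≤ wt (ew A) i l ∧
      ∃ u ∈ i :: l, u ∈ critNodes A lam := by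
  by_contra hno
  have hno' : ∀ l, Wk (ED A) i l j → l.length = l₀.length → wt (ew A) i l₀ ≤ wt (ew A) i l →
      ∀ u ∈ i :: l, u ∉ critNodes A lam := by
    intro l h1 h2 h3 u h4 h5
    exact hno ⟨l, h1, h2, h3, u, h4, h5⟩
  clear hno
  obtain ⟨⟨W, hW1, hW2⟩, hmax⟩ := id hlam
  obtain ⟨k, cc, rfl, hcc, -⟩ := cyc_of hW1 hW2
  have hik : i ≠ k := by
    rintro rfl
    exact hno' l₀ h₀ rfl le_rfl i (by simp) (mem_crit.2 ⟨cc, hcc⟩)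
  have hn2 : 2 ≤ n := by
    by_contra hcon
    apply hik
    apply Fin.ext
    have := i.2
    have := k.2
    omega
  rw [wielandt, if_neg (by omega)] at ht
  have htn : n ≤ l₀.length := by
    obtain ⟨m, rfl⟩ : ∃ m, n = m + 2 := ⟨n - 2, by omega⟩
    have e2 : m + 2 - 1 = m + 1 := by omega
    rw [e2] at ht
    nlinarith
  let M : Set ℝ := {m | ∃ l x c, (Wk (ED A) i l j ∧ l.length = l₀.length ∧
    wt (ew A) i l₀ ≤ wt (ew A) i l) ∧ Cyc A m x c ∧ ∃ y ∈ c, y ∈ i :: l}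
  have hMf : M.Finite := means_finite.subset (by
    rintro m ⟨l, x, c, _, h, _⟩; exact ⟨x, c, h⟩)
  have hMn : M.Nonempty := by
    obtain ⟨m, x, c, h1, h2⟩ := has_cycle h₀ htn
    exact ⟨m, l₀, x, c, ⟨h₀, rfl, le_rfl⟩, h1, h2⟩
  obtain ⟨m, hmM, hmm⟩ := Set.exists_max_image M id hMf hMn
  simp only [id] at hmm
  obtain ⟨l, x, c, hl, hc, y, hyc, hyl⟩ := hmM
  have hml : m ≤ lam := hmax _ _ (of_cyc hc).1 (of_cyc hc).2
  have claim : ∃ l y w, (Wk (ED A) i l j ∧ l.length = l₀.length ∧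
      wt (ew A) i l₀ ≤ wt (ew A) i l) ∧ y ∈ i :: l ∧ w ∈ critNodes A lam ∧
      ReachIn (thrCT A (m : WithBot ℝ)) y w := by
    by_cases hfree : HasFreeScc (thrCT A (m : WithBot ℝ)) (critSub A lam)
    · rcases hμ with ⟨h1, h2, h3⟩ | ⟨h1, h2⟩
      · have hmμ := h3 m (WithBot.coe_le_coe.2 hml) hfree
        obtain ⟨hv1, w, hw, hvw⟩ := hvc
        induction μ with
        | bot => simp at hmμ
        | coe μ =>
          rw [WithBot.coe_le_coe] at hmμ
          obtain ⟨m', x', c', g1, g2, g3⟩ := thr_vert.1 hv1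
          have := hmm m' ⟨l₀, x', c', ⟨h₀, rfl, le_rfl⟩, g1, v, g3, hv⟩
          have hμm : μ = m := by linarith
          subst hμm
          exact ⟨l₀, v, w, ⟨h₀, rfl, le_rfl⟩, hv, hw, hvw.1⟩
      · exact absurd hfree (h2 m (WithBot.coe_le_coe.2 hml))
    · unfold HasFreeScc at hfree
      push Not at hfree
      obtain ⟨w, hw, hsub⟩ := hfree y (thr_vert.2 ⟨m, x, c, hc, le_rfl, hyc⟩)
      have hrefl : ReachIn (critSub A lam) w w :=
        ⟨[w], ⟨by simp, by simpa using hw, by simp [List.Chain']⟩, by simp, by simp⟩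
      have : w ∈ sccOf (thrCT A (m : WithBot ℝ)) y := hsub ⟨hrefl, hrefl⟩
      exact ⟨l, y, w, hl, hyl, hw, this.1⟩
  clear hl hc hyc hyl
  obtain ⟨l, y, w, hl, hyl, hw, hreach⟩ := claim
  obtain ⟨r, hr, -⟩ := reach_wk hreach
  clear hreach
  induction r generalizing y l with
  | nil =>
    rw [Wk_nil] at hr; subst hr
    exact hno' l hl.1 hl.2.1 hl.2.2 y hyl hw
  | cons y1 r ih =>
    obtain ⟨m', x', c', g1, g2, g3, g4⟩ := thr_edge hr.1
    have hNP : NP (ED A) (aL A m) (i :: l).toFinset := by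
      apply NP_of_cycles
      intro k' q q1 q2 q3 q4
      have hlq : (0:ℝ) < q.length := by exact_mod_cast List.length_pos_iff.2 q2
      have hC : Cyc A (wt (ew A) k' q / q.length) k' q := ⟨q1, q2, q3, by field_simp⟩
      have := hmm _ ⟨l, k', q, hl, hC, k', q1.last_mem' q2,
        List.mem_toFinset.1 (q4 k' (q1.last_mem' q2))⟩
      rw [div_le_iff₀ hlq] at this
      rw [wt_aL]; linarith
    have hnn : ∀ (m'' : ℝ) (x'' : Fin n) (c'' : List (Fin n)), Cyc A m'' x'' c'' → m ≤ m'' →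
        0 ≤ wt (aL A m) x'' c'' := by
      intro m'' x'' c'' hC hm
      rw [wt_aL, hC.2.2.2, ← mul_sub]
      exact mul_nonneg (Nat.cast_nonneg _) (by linarith)
    obtain ⟨l', e1, e2, e3, e4⟩ := step hl.1 (by rw [hl.2.1]; exact ht) hNP g1.1 g1.2.1 g1.2.2.1
      (hnn _ _ _ g1 g2) ⟨y, hyl, g3⟩ hcc.1 hcc.2.1 hcc.2.2.1 (hnn _ _ _ hcc hml) (by
        intro q hq hq'
        exact hno' l hl.1 hl.2.1 hl.2.2 q hq' (cyc_mem_crit hcc hq))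
    rw [wt_aL, wt_aL, e2] at e3
    exact ih l' y1 ⟨e1, by rw [e2, hl.2.1], by linarith [hl.2.2]⟩ (e4 y1 g4) hr.2

theorem rep_B (S : Set (Fin n)) :
    Rep (zeroRC A S) (fun x y => ED A x y ∧ x ∉ S ∧ y ∉ S) (ew A) := by
  intro x y
  constructor
  · rintro ⟨h1, h2, h3⟩
    simp only [zeroRC, h2, h3, or_self, if_false]
    exact ew_coe h1
  · intro h
    simp only [zeroRC]
    split_ifs with hs
    · rfl
    · push Not at hs
      by_contra hA
      exact h ⟨hA, hs⟩

theorem le_csr (hlam : IsMaxCycleMean A lam) (hG : IsRepresenting (critSub A lam) G)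
    {i j u : Fin n} {l : List (Fin n)} (h : Wk (ED A) i l j) (hu : u ∈ i :: l)
    (huc : u ∈ critNodes A lam) :
    ((wt (ew A) i l : ℝ) : WithBot ℝ) ≤
      csr A lam G l.length i j + (((l.length : ℝ) * lam : ℝ) : WithBot ℝ) := by
  have := add_le_add (csr_lower hlam hG h hu huc)
    (le_refl ((((l.length : ℝ) * lam : ℝ)) : WithBot ℝ))
  refine le_trans (le_of_eq ?_) this
  rw [← WithBot.coe_add, wt_aL]
  congr 1; ring

theorem main_thm (A : MPMat n) (lam : ℝ)
    (hlam : IsMaxCycleMean A lam) (μ : WithBot ℝ) (hμ : IsMuCT A lam μ)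
    (G : SubD n) (hG : IsRepresenting (critSub A lam) G) :
    ∀ t, wielandt n ≤ t → weakCSReq A (bCT A lam μ) lam G t := by
  intro t ht i j
  apply le_antisymm
  · by_cases hb : mpPow A t i j = ⊥
    · rw [hb]; exact bot_le
    obtain ⟨l, h1, h2, h3⟩ := pow_ex rep_A hb
    rw [h3]
    by_cases hct : ∃ v ∈ i :: l, v ∈ ctNodes A lam μ
    · obtain ⟨v, hv, hvc⟩ := hct
      obtain ⟨l', e1, e2, e3, u, hu, huc⟩ := ct_walk hlam hμ h1 (by rw [h2]; exact ht) hv hvc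
      refine le_trans ?_ (le_max_left _ _)
      have := le_csr hlam hG e1 hu huc
      rw [e2, h2] at this
      exact le_trans (WithBot.coe_le_coe.2 e3) this
    · push Not at hct
      refine le_trans ?_ (le_max_right _ _)
      have hw := h1.mono_mem (E' := fun x y => ED A x y ∧ x ∉ ctNodes A lam μ ∧ y ∉ ctNodes A lam μ)
        (fun x y hx hy h => ⟨h, hct x hx, hct y hy⟩)
      have := pow_ge (rep_B (ctNodes A lam μ)) hw
      rw [h2] at this
      exact this
  · apply max_le (csr_upper hlam hG ht i j)
    by_cases hb : mpPow (bCT A lam μ) t i j = ⊥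
    · rw [hb]; exact bot_le
    obtain ⟨l, h1, h2, h3⟩ := pow_ex (rep_B (ctNodes A lam μ)) hb
    have h3' : mpPow (bCT A lam μ) t i j = ((wt (ew A) i l : ℝ) : WithBot ℝ) := h3
    rw [h3']
    have := pow_ge rep_A (h1.mono fun x y h => h.1)
    rw [h2] at this
    exact this

end helpers7

/-- For `B^{ct}` the cycle threshold scheme,
`T₁(A,B^{ct}) ≤ Wi(n)`. -/
theorem weakCSR_threshold_ct_le_wielandt {n : ℕ} (hn : 1 ≤ n) (A : MPMat n) (lam : ℝ)
    (hlam : IsMaxCycleMean A lam) (μ : WithBot ℝ) (hμ : IsMuCT A lam μ)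
    (G : SubD n) (hG : IsRepresenting (critSub A lam) G) :
    ∀ t, wielandt n ≤ t → weakCSReq A (bCT A lam μ) lam G t := by
  exact main_thm A lam hlam μ hμ G hG

end MaxPlus
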